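/- In the exterior Dirichlet setting with x₀ = R·eₙ ∈ ∂B_R, δ = R^{3/4}, Ω_δ = B_δ(x₀) ∩ B_R, u = u^R, ϑ := (u − u̲) + R^{−1/2}·d − (1/2)·R^{−5/4}·d² with d(x) = R − |x|, T = ∂_t − (x_t/R)∂_n for a fixed t < n, and L the linearized operator Lw = u^{ij}w_{ij} − (n+2)/(1+|Du|²)·uⁱw_i: there exists a constant A > 0 independent of R such that for all sufficiently large R, each of the functions Θ_± := ϑ + A·R^{−2}·|x − x₀|² ± T(u − u̲) satisfies LΘ_± ≤ 0 in Ω_δ and Θ_± ≥ 0 on ∂Ω_δ. -/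

import Mathlib

open Metric Set Filter
open scoped Topology RealInnerProductSpace

noncomputable section

abbrev Euc (n : ℕ) : Type := EuclideanSpace ℝ (Fin n)

/-- The Hessian matrix of `u` at `x`, `(u_{ij})`. -/
noncomputable def Hess {n : ℕ} (u : Euc n → ℝ) (x : Euc n) : Matrix (Fin n) (Fin n) ℝ :=
  fun i j => iteratedFDeriv ℝ 2 u x ![EuclideanSpace.single i 1, EuclideanSpace.single j 1]

/-- The Gauß curvature operator `K[u] = det D²u / (1+|Du|²)^((n+2)/2)`. -/
noncomputable def gaussK {n : ℕ} (u : Euc n → ℝ) (x : Euc n) : ℝ :=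
  (Hess u x).det / (1 + ‖fderiv ℝ u x‖ ^ 2) ^ (((n : ℝ) + 2) / 2)

/-- Partial derivative `w_i` relative to a set `S`. -/
noncomputable def pdW {n : ℕ} (S : Set (Euc n)) (w : Euc n → ℝ) (x : Euc n) (i : Fin n) : ℝ :=
  fderivWithin ℝ w S x (EuclideanSpace.single i 1)

/-- The Hessian matrix `(w_{ij})` relative to a set `S`. -/
noncomputable def HessW {n : ℕ} (S : Set (Euc n)) (w : Euc n → ℝ) (x : Euc n) :
    Matrix (Fin n) (Fin n) ℝ :=
  fun i j => iteratedFDerivWithin ℝ 2 w S x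
    ![EuclideanSpace.single i 1, EuclideanSpace.single j 1]

/-- The exterior Dirichlet setting of Finster–Schnürer. -/
structure ExtSetting (n : ℕ) where
  K : Set (Euc n)
  f : Euc n → ℝ → ℝ
  u₀ : Euc n → ℝ
  ul : Euc n → ℝ
  R₀ : ℝ
  hn : 2 ≤ n
  hR₀ : 0 < R₀
  hKne : K.Nonempty
  hKc : IsCompact K
  hK0 : 0 ∈ interior K
  hKsm : ∃ g : Euc n → ℝ, ContDiff ℝ (⊤ : ℕ∞) g ∧ K = {x | g x ≤ 0} ∧
    ∀ x ∈ frontier K, fderiv ℝ g x ≠ 0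
  hKR₀ : K ⊆ ball 0 R₀
  hfsm : ContDiffOn ℝ (⊤ : ℕ∞) (fun p : Euc n × ℝ => f p.1 p.2) ((interior K)ᶜ ×ˢ univ)
  hfpos : ∀ x ∈ (interior K)ᶜ, ∀ z : ℝ, 0 < f x z
  hfz : ∀ x ∈ (interior K)ᶜ, Monotone (f x)
  hfdec : ∃ C : ℝ, ∀ x ∈ (interior K)ᶜ, ∀ z : ℝ, f x z * ‖x‖ ^ (n + 1) ≤ C
  hfder : ∃ C : ℝ, ∀ p ∈ (interior K)ᶜ ×ˢ (univ : Set ℝ),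
    ‖fderivWithin ℝ (fun q : Euc n × ℝ => f q.1 q.2) ((interior K)ᶜ ×ˢ univ) p‖ +
      ‖iteratedFDerivWithin ℝ 2 (fun q : Euc n × ℝ => f q.1 q.2) ((interior K)ᶜ ×ˢ univ) p‖
        ≤ C * f p.1 p.2
  hulsm : ContDiffOn ℝ (⊤ : ℕ∞) ul (interior K)ᶜ
  hulconv : ∀ x ∈ Kᶜ, (Hess ul x).PosDef
  hulsub : ∀ x ∈ Kᶜ, f x (ul x) ≤ gaussK ul x
  hulbc : ∀ x ∈ frontier K, ul x = u₀ x
  hulcone : ∃ C : ℝ, ∀ x ∈ (interior K)ᶜ, |ul x - ‖x‖| ≤ C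
  huldec1 : ∃ C R₁ : ℝ, ∀ x : Euc n, R₁ ≤ ‖x‖ →
    ‖fderiv ℝ (fun y => ul y - ‖y‖) x‖ ≤ C / ‖x‖
  huldec2 : ∃ C R₁ : ℝ, ∀ x : Euc n, R₁ ≤ ‖x‖ →
    ‖iteratedFDeriv ℝ 2 (fun y => ul y - ‖y‖) x‖ + ‖iteratedFDeriv ℝ 3 ul x‖ ≤ C / ‖x‖ ^ 2

/-- The domain `B_R ∖ int K` of the compact Dirichlet problem. -/
def solDom {n : ℕ} (S : ExtSetting n) (R : ℝ) : Set (Euc n) :=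
  closedBall 0 R \ interior S.K

/-- `u` is a smooth strictly convex solution `u^R` of the compact Dirichlet problem
`K[u^R] = f(x,u^R)` in `B_R ∖ K`, `u^R = u̲` on `∂B_R ∪ ∂K`. -/
def IsSol {n : ℕ} (S : ExtSetting n) (R : ℝ) (u : Euc n → ℝ) : Prop :=
  ContDiffOn ℝ (⊤ : ℕ∞) u (solDom S R) ∧
  (∀ x ∈ ball 0 R \ S.K, (Hess u x).PosDef) ∧
  (∀ x ∈ ball 0 R \ S.K, gaussK u x = S.f x (u x)) ∧
  (∀ x ∈ sphere (0 : Euc n) R ∪ frontier S.K, u x = S.ul x)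

/-- The tangential operator `Tw = w_t − (x_t/R)·w_n` (with `n` the last index). -/
noncomputable def Tlin {n : ℕ} (Ω : Set (Euc n)) (R : ℝ) (t last : Fin n) (w : Euc n → ℝ)
    (x : Euc n) : ℝ :=
  pdW Ω w x t - x t / R * pdW Ω w x last

/-- The linearized operator `Lw = u^{ij} w_{ij} − (n+2)/(1+|Du|²) uⁱ w_i`. -/
noncomputable def Llin {n : ℕ} (Ω : Set (Euc n)) (u w : Euc n → ℝ) (x : Euc n) : ℝ :=
  (∑ i, ∑ j, (HessW Ω u x)⁻¹ i j * HessW Ω w x i j) -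
    ((n : ℝ) + 2) / (1 + ∑ i, pdW Ω u x i ^ 2) * ∑ i, pdW Ω u x i * pdW Ω w x i

/-- The barrier function `ϑ = (u − u̲) + R^{-1/2} d − (1/2) R^{-5/4} d²`, `d = R − |x|`. -/
noncomputable def vartheta {n : ℕ} (R : ℝ) (u ul : Euc n → ℝ) (x : Euc n) : ℝ :=
  (u x - ul x) + R ^ (-(1 : ℝ) / 2) * (R - ‖x‖) - 1 / 2 * R ^ (-(5 : ℝ) / 4) * (R - ‖x‖) ^ 2

open scoped MatrixOrder in
theorem Matrix.PosSemidef.exists_sum_mul {n : ℕ} {B : Matrix (Fin n) (Fin n) ℝ}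
    (hB : B.PosSemidef) :
    ∃ c : Fin n → Fin n → ℝ, ∀ i j, B i j = ∑ k, c k i * c k j := by
  obtain ⟨C, hC⟩ := CStarAlgebra.nonneg_iff_eq_star_mul_self.mp hB.nonneg
  refine ⟨fun k i => C k i, fun i j => ?_⟩
  rw [hC, Matrix.mul_apply]
  simp

/-- The pairing of a positive semidefinite matrix with a nonnegative form is nonnegative. -/
theorem Matrix.PosSemidef.sum_mul_nonneg {n : ℕ} {B : Matrix (Fin n) (Fin n) ℝ}
    (hB : B.PosSemidef) {m : Fin n → Fin n → ℝ}
    (hm : ∀ v : Fin n → ℝ, 0 ≤ ∑ i, ∑ j, v i * v j * m i j) :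
    0 ≤ ∑ i, ∑ j, B i j * m i j := by
  obtain ⟨c, hc⟩ := hB.exists_sum_mul
  have : ∑ i, ∑ j, B i j * m i j = ∑ k, ∑ i, ∑ j, c k i * c k j * m i j := by
    simp_rw [hc, Finset.sum_mul]
    rw [Finset.sum_comm' (t' := Finset.univ) (s' := fun _ => Finset.univ) (by simp)]
    conv_rhs => rw [Finset.sum_comm]
    rw [Finset.sum_comm]
    exact Finset.sum_congr rfl fun i _ => Finset.sum_comm
  rw [this]
  exact Finset.sum_nonneg fun k _ => hm (c k)

theorem Matrix.PosSemidef.abs_apply_le_trace {n : ℕ} {B : Matrix (Fin n) (Fin n) ℝ}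
    (hB : B.PosSemidef) (i j : Fin n) : |B i j| ≤ B.trace := by
  obtain ⟨c, hc⟩ := hB.exists_sum_mul
  have h1 : |B i j| ≤ (B i i + B j j) / 2 := by
    rw [hc, hc, hc, ← Finset.sum_add_distrib, Finset.sum_div]
    refine (Finset.abs_sum_le_sum_abs _ _).trans (Finset.sum_le_sum fun k _ => ?_)
    rw [abs_mul]
    nlinarith [sq_nonneg (|c k i| - |c k j|), abs_mul_abs_self (c k i), abs_mul_abs_self (c k j)]
  have h2 : ∀ i, B i i ≤ B.trace := fun i =>
    Finset.single_le_sum (f := fun i => B i i) (fun k _ => hB.diag_nonneg) (Finset.mem_univ i)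
  linarith [h2 i, h2 j]

theorem Matrix.PosSemidef.abs_sum_mul_le {n : ℕ} {B : Matrix (Fin n) (Fin n) ℝ}
    (hB : B.PosSemidef) {m : Fin n → Fin n → ℝ} {C : ℝ} (hm : ∀ i j, |m i j| ≤ C) :
    |∑ i, ∑ j, B i j * m i j| ≤ n ^ 2 * C * B.trace := by
  have hb : ∀ i j, |B i j * m i j| ≤ B.trace * C := fun i j => by
    rw [abs_mul]
    exact mul_le_mul (hB.abs_apply_le_trace i j) (hm i j) (abs_nonneg _) hB.trace_nonneg
  calc |∑ i, ∑ j, B i j * m i j| ≤ ∑ i, ∑ j, |B i j * m i j| :=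
        (Finset.abs_sum_le_sum_abs _ _).trans
          (Finset.sum_le_sum fun i _ => Finset.abs_sum_le_sum_abs _ _)
    _ ≤ ∑ _i : Fin n, ∑ _j : Fin n, B.trace * C :=
        Finset.sum_le_sum fun i _ => Finset.sum_le_sum fun j _ => hb i j
    _ = n ^ 2 * C * B.trace := by simp; ring

/-- Concavity of `log det` on positive definite matrices, as a tangent plane inequality. -/
theorem Matrix.PosDef.log_det_le {n : ℕ} {A B : Matrix (Fin n) (Fin n) ℝ}
    (hA : A.PosDef) (hB : B.PosDef) :
    n + Real.log B.det - Real.log A.det ≤ ∑ i, ∑ j, A⁻¹ i j * B i j := by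
  obtain ⟨c, hc⟩ := hA.inv.posSemidef.exists_sum_mul
  set C : Matrix (Fin n) (Fin n) ℝ := Matrix.of c with hC
  have hCA : A⁻¹ = C.transpose * C := by
    ext i j
    rw [hc, Matrix.mul_apply]
    rfl
  have hdA : 0 < A.det := hA.det_pos
  have hdB : 0 < B.det := hB.det_pos
  have hdet : C.det ^ 2 = (A.det)⁻¹ := by
    rw [← Ring.inverse_eq_inv', ← Matrix.det_nonsing_inv, hCA, Matrix.det_mul,
      Matrix.det_transpose, sq]
  set M : Matrix (Fin n) (Fin n) ℝ := C * B * C.conjTranspose with hM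
  have hMh : M.PosSemidef := hB.posSemidef.mul_mul_conjTranspose_same C
  have hMdet : M.det = B.det / A.det := by
    rw [hM, Matrix.det_mul, Matrix.det_mul, Matrix.det_conjTranspose, star_trivial, div_eq_mul_inv,
      ← hdet]
    ring
  have hMpd : M.PosDef := hMh.posDef_iff_det_ne_zero.mpr (by rw [hMdet]; positivity)
  have htr : ∑ i, ∑ j, A⁻¹ i j * B i j = M.trace := by
    have hBs : ∀ i j, B i j = B j i := fun i j => by
      simpa using (hB.isHermitian.apply i j).symm
    rw [hM, Matrix.trace_mul_comm, ← Matrix.mul_assoc, Matrix.conjTranspose_eq_transpose_of_trivial,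
      ← hCA, Matrix.trace]
    simp only [Matrix.diag, Matrix.mul_apply]
    exact Finset.sum_congr rfl fun i _ => Finset.sum_congr rfl fun j _ => by rw [hBs i j]
  have hlog : Real.log B.det - Real.log A.det = ∑ i, Real.log (hMpd.1.eigenvalues i) := by
    rw [← Real.log_div hdB.ne' hdA.ne', ← hMdet, hMpd.1.det_eq_prod_eigenvalues]
    simp only [RCLike.ofReal_real_eq_id, id]
    exact Real.log_prod (fun i _ => (hMpd.eigenvalues_pos i).ne')
  rw [htr, hMpd.1.trace_eq_sum_eigenvalues, add_sub_assoc, hlog]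
  have : (n : ℝ) = ∑ _i : Fin n, (1 : ℝ) := by simp
  rw [this, ← Finset.sum_add_distrib]
  refine Finset.sum_le_sum fun i _ => ?_
  have := Real.log_le_sub_one_of_pos (hMpd.eigenvalues_pos i)
  simp only [RCLike.ofReal_real_eq_id, id]
  linarith

/-- For a unit vector `ν`, the matrix `b (1 - ν νᵀ) + c ν νᵀ` is positive definite, with
determinant `b ^ (n - 1) c`. -/
theorem posDef_and_det_rankOne {n : ℕ} (hn : 1 ≤ n) {ν : Fin n → ℝ} (hν : ∑ i, ν i ^ 2 = 1)
    {b c : ℝ} (hb : 0 < b) (hc : 0 < c) :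
    (Matrix.of fun i j => b * ((if i = j then 1 else 0) - ν i * ν j) + c * (ν i * ν j)).PosDef ∧
    (Matrix.of fun i j => b * ((if i = j then 1 else 0) - ν i * ν j) + c * (ν i * ν j)).det
      = b ^ (n - 1) * c := by
  set M : Matrix (Fin n) (Fin n) ℝ :=
    Matrix.of fun i j => b * ((if i = j then 1 else 0) - ν i * ν j) + c * (ν i * ν j) with hM
  have hMeq : M = b • (1 + Matrix.replicateCol Unit (fun i => ((c - b) / b) * ν i) *
      Matrix.replicateRow Unit ν) := by
    ext i j
    simp only [hM, Matrix.of_apply, Matrix.smul_apply, Matrix.add_apply, Matrix.mul_apply,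
      Matrix.one_apply, Matrix.replicateCol_apply, Matrix.replicateRow_apply, smul_eq_mul]
    simp
    field_simp
    ring
  have hdet : M.det = b ^ (n - 1) * c := by
    have hdot : ν ⬝ᵥ (fun i => ((c - b) / b) * ν i) = (c - b) / b := by
      rw [dotProduct]
      calc ∑ i, ν i * ((c - b) / b * ν i) = ((c - b) / b) * ∑ i, ν i ^ 2 := by
            rw [Finset.mul_sum]; exact Finset.sum_congr rfl fun i _ => by ring
        _ = _ := by rw [hν, mul_one]
    rw [hMeq, Matrix.det_smul, Matrix.det_one_add_replicateCol_mul_replicateRow, hdot,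
      Fintype.card_fin]
    obtain ⟨k, rfl⟩ := Nat.exists_eq_add_of_le' hn
    simp only [Nat.add_sub_cancel, pow_succ]
    field_simp
    ring
  have hsd : M.PosSemidef := by
    refine Matrix.PosSemidef.of_dotProduct_mulVec_nonneg ?_ fun v => ?_
    · ext i j
      simp only [hM, Matrix.conjTranspose_apply, Matrix.of_apply, star_trivial]
      simp only [eq_comm (a := i), mul_comm (ν i)]
    · have hCS : (∑ i, v i * ν i) ^ 2 ≤ ∑ i, v i ^ 2 := by
        have := Finset.sum_mul_sq_le_sq_mul_sq Finset.univ v ν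
        rwa [hν, mul_one] at this
      have : star v ⬝ᵥ M.mulVec v
          = b * (∑ i, v i ^ 2 - (∑ i, v i * ν i) ^ 2) + c * (∑ i, v i * ν i) ^ 2 := by
        have e1 : (∑ i, v i * ν i) ^ 2 = ∑ i, ∑ j, v i * ν i * (v j * ν j) := by
          rw [sq, Finset.sum_mul_sum]
        have e2 : ∑ i, v i ^ 2 = ∑ i, ∑ j, if i = j then v i * v j else 0 := by
          simp [sq]
        rw [e1, e2, ← Finset.sum_sub_distrib, Finset.mul_sum, Finset.mul_sum,
          ← Finset.sum_add_distrib]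
        simp only [dotProduct, Matrix.mulVec, star_trivial, hM, Matrix.of_apply]
        refine Finset.sum_congr rfl fun i _ => ?_
        rw [Finset.mul_sum, ← Finset.sum_sub_distrib, Finset.mul_sum, Finset.mul_sum,
          ← Finset.sum_add_distrib]
        refine Finset.sum_congr rfl fun j _ => ?_
        split_ifs <;> ring
      rw [this]
      have := sub_nonneg.mpr hCS
      positivity
  exact ⟨hsd.posDef_iff_det_ne_zero.mpr (by rw [hdet]; positivity), hdet⟩

/-- The partial derivative `w_i`. -/
def pd {n : ℕ} (i : Fin n) (w : Euc n → ℝ) (x : Euc n) : ℝ :=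
  fderiv ℝ w x (EuclideanSpace.single i 1)

section Partial

variable {n : ℕ} {O : Set (Euc n)} {v w : Euc n → ℝ} {x : Euc n}

theorem ContDiffOn.pd (hO : IsOpen O) (hw : ContDiffOn ℝ (⊤ : ℕ∞) w O) (i : Fin n) :
    ContDiffOn ℝ (⊤ : ℕ∞) (pd i w) O :=
  (hw.fderiv_of_isOpen hO (by simp)).clm_apply contDiffOn_const

theorem ContDiffOn.differentiableAt_of_isOpen (hO : IsOpen O) (hw : ContDiffOn ℝ (⊤ : ℕ∞) w O)
    (hx : x ∈ O) : DifferentiableAt ℝ w x :=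
  (hw.contDiffAt (hO.mem_nhds hx)).differentiableAt (by simp)

theorem fderiv_eq_of_eqOn (hO : IsOpen O) (h : EqOn v w O) (hx : x ∈ O) :
    fderiv ℝ v x = fderiv ℝ w x :=
  (h.eventuallyEq_of_mem (hO.mem_nhds hx)).fderiv_eq

theorem pd_congr (hO : IsOpen O) (h : EqOn v w O) (i : Fin n) : EqOn (pd i v) (pd i w) O :=
  fun x hx => by simp only [pd, fderiv_eq_of_eqOn hO h hx]

theorem pd_add (hO : IsOpen O) (hv : ContDiffOn ℝ (⊤ : ℕ∞) v O)
    (hw : ContDiffOn ℝ (⊤ : ℕ∞) w O) (i : Fin n) :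
    EqOn (pd i fun y => v y + w y) (fun y => pd i v y + pd i w y) O := fun x hx => by
  simp only [pd]
  rw [fderiv_fun_add (hv.differentiableAt_of_isOpen hO hx) (hw.differentiableAt_of_isOpen hO hx)]
  rfl

theorem pd_sub (hO : IsOpen O) (hv : ContDiffOn ℝ (⊤ : ℕ∞) v O)
    (hw : ContDiffOn ℝ (⊤ : ℕ∞) w O) (i : Fin n) :
    EqOn (pd i fun y => v y - w y) (fun y => pd i v y - pd i w y) O := fun x hx => by
  simp only [pd]
  rw [fderiv_fun_sub (hv.differentiableAt_of_isOpen hO hx) (hw.differentiableAt_of_isOpen hO hx)]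
  rfl

theorem pd_mul (hO : IsOpen O) (hv : ContDiffOn ℝ (⊤ : ℕ∞) v O)
    (hw : ContDiffOn ℝ (⊤ : ℕ∞) w O) (i : Fin n) :
    EqOn (pd i fun y => v y * w y) (fun y => v y * pd i w y + w y * pd i v y) O := fun x hx => by
  simp only [pd]
  rw [fderiv_fun_mul (hv.differentiableAt_of_isOpen hO hx) (hw.differentiableAt_of_isOpen hO hx)]
  rfl

theorem pd_const (c : ℝ) (i : Fin n) : pd i (fun _ => c) = fun _ => 0 := by
  ext x
  simp [pd]

theorem pd_coord (i t : Fin n) :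
    pd i (fun y : Euc n => y t) = fun _ => if i = t then 1 else 0 := by
  ext x
  have : HasFDerivAt (fun y : Euc n => y t) (EuclideanSpace.proj t : Euc n →L[ℝ] ℝ) x :=
    (EuclideanSpace.proj t : Euc n →L[ℝ] ℝ).hasFDerivAt
  simp [pd, this.fderiv, eq_comm]

theorem pd_pd_comm (hO : IsOpen O) (hw : ContDiffOn ℝ (⊤ : ℕ∞) w O) (i j : Fin n) :
    EqOn (pd i (pd j w)) (pd j (pd i w)) O := fun x hx => by
  have hs : IsSymmSndFDerivAt ℝ w x :=
    (hw.contDiffAt (hO.mem_nhds hx)).isSymmSndFDerivAt (by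
      rw [minSmoothness_of_isRCLikeNormedField]
      exact WithTop.coe_le_coe.mpr le_top)
  have hd : DifferentiableAt ℝ (fderiv ℝ w) x :=
    ((hw.fderiv_of_isOpen (m := (⊤ : ℕ∞)) hO (by simp)).contDiffAt
      (hO.mem_nhds hx)).differentiableAt (by simp)
  have h : ∀ i j, pd i (pd j w) x =
      fderiv ℝ (fderiv ℝ w) x (EuclideanSpace.single i 1) (EuclideanSpace.single j 1) := by
    intro i j
    unfold pd
    rw [fderiv_clm_apply hd (differentiableAt_const _)]
    simp
  rw [h, h, hs]

theorem iteratedFDeriv_two_single (hO : IsOpen O) (hw : ContDiffOn ℝ (⊤ : ℕ∞) w O) (hx : x ∈ O)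
    (i j : Fin n) :
    iteratedFDeriv ℝ 2 w x ![EuclideanSpace.single i 1, EuclideanSpace.single j 1]
      = pd i (pd j w) x := by
  have hd : DifferentiableAt ℝ (fderiv ℝ w) x :=
    ((hw.fderiv_of_isOpen (m := (⊤ : ℕ∞)) hO (by simp)).contDiffAt
      (hO.mem_nhds hx)).differentiableAt (by simp)
  rw [iteratedFDeriv_two_apply]
  unfold pd
  rw [fderiv_clm_apply hd (differentiableAt_const _)]
  simp

theorem Hess_apply (hO : IsOpen O) (hw : ContDiffOn ℝ (⊤ : ℕ∞) w O) (hx : x ∈ O)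
    (i j : Fin n) : Hess w x i j = pd i (pd j w) x :=
  iteratedFDeriv_two_single hO hw hx i j

theorem iteratedFDeriv_three_single (hO : IsOpen O) (hw : ContDiffOn ℝ (⊤ : ℕ∞) w O) (hx : x ∈ O)
    (i j k : Fin n) :
    iteratedFDeriv ℝ 3 w x
      ![EuclideanSpace.single i 1, EuclideanSpace.single j 1, EuclideanSpace.single k 1]
      = pd i (pd j (pd k w)) x := by
  have hd : DifferentiableAt ℝ (iteratedFDeriv ℝ 2 w) x :=
    (hw.contDiffAt (hO.mem_nhds hx)).differentiableAt_iteratedFDeriv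
      (WithTop.coe_lt_coe.mpr (WithTop.coe_lt_top 2))
  rw [hd.iteratedFDeriv_succ_apply_left']
  have : EqOn (fun y => iteratedFDeriv ℝ 2 w y
      ![EuclideanSpace.single j 1, EuclideanSpace.single k 1]) (pd j (pd k w)) O :=
    fun y hy => iteratedFDeriv_two_single hO hw hy j k
  exact pd_congr hO this i hx

theorem abs_iteratedFDeriv_single_le (m : ℕ) (w : Euc n → ℝ) (x : Euc n) (e : Fin m → Fin n) :
    |iteratedFDeriv ℝ m w x (fun k => EuclideanSpace.single (e k) 1)|
      ≤ ‖iteratedFDeriv ℝ m w x‖ := by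
  have := (iteratedFDeriv ℝ m w x).le_opNorm (fun k => EuclideanSpace.single (e k) (1 : ℝ))
  simpa using this

theorem sum_smul_single (v : Euc n) :
    ∑ i, v i • (EuclideanSpace.single i (1 : ℝ) : Euc n) = v := by
  ext j
  simp [Finset.sum_apply, Pi.single_apply]

theorem clm_apply_eq_sum (ℓ : Euc n →L[ℝ] ℝ) (v : Euc n) :
    ℓ v = ∑ i, v i * ℓ (EuclideanSpace.single i 1) := by
  conv_lhs => rw [← sum_smul_single v]
  simp

theorem norm_sq_clm (ℓ : Euc n →L[ℝ] ℝ) :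
    ‖ℓ‖ ^ 2 = ∑ i, ℓ (EuclideanSpace.single i 1) ^ 2 := by
  obtain ⟨g, rfl⟩ := (InnerProductSpace.toDual ℝ (Euc n)).surjective ℓ
  simp [EuclideanSpace.norm_sq_eq, EuclideanSpace.inner_single_right]

theorem norm_sq_fderiv (w : Euc n → ℝ) (x : Euc n) :
    ‖fderiv ℝ w x‖ ^ 2 = ∑ i, pd i w x ^ 2 := norm_sq_clm _

theorem abs_pd_le (w : Euc n → ℝ) (x : Euc n) (i : Fin n) : |pd i w x| ≤ ‖fderiv ℝ w x‖ := by
  simpa [pd] using (fderiv ℝ w x).le_opNorm (EuclideanSpace.single i 1)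

theorem contDiffOn_norm : ContDiffOn ℝ (⊤ : ℕ∞) (fun y : Euc n => ‖y‖) {0}ᶜ :=
  fun _ hy => (contDiffAt_norm ℝ hy).contDiffWithinAt

theorem pd_normSq (x₀ : Euc n) (i : Fin n) :
    pd i (fun y : Euc n => ‖y - x₀‖ ^ 2) = fun y => 2 * (y i - x₀ i) := by
  ext x
  have h := ((hasFDerivAt_id x).sub_const x₀).norm_sq
  simp only [pd]
  erw [h.fderiv]
  simp [EuclideanSpace.inner_single_right]

theorem pd_norm (hx : x ≠ 0) (i : Fin n) : pd i (fun y : Euc n => ‖y‖) x = x i / ‖x‖ := by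
  have hO : IsOpen ({0}ᶜ : Set (Euc n)) := isOpen_compl_singleton
  have h1 := pd_mul hO contDiffOn_norm contDiffOn_norm i hx
  have h2 : pd i (fun y : Euc n => ‖y‖ * ‖y‖) x = 2 * x i := by
    have := congrFun (pd_normSq (0 : Euc n) i) x
    simpa [sq] using this
  rw [h2] at h1
  have : ‖x‖ ≠ 0 := norm_ne_zero_iff.mpr hx
  field_simp
  simp only at h1
  linarith

theorem pd_pd_norm (hx : x ≠ 0) (i j : Fin n) :
    pd i (pd j fun y : Euc n => ‖y‖) x
      = ((if i = j then 1 else 0) - x i / ‖x‖ * (x j / ‖x‖)) / ‖x‖ := by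
  have hO : IsOpen ({0}ᶜ : Set (Euc n)) := isOpen_compl_singleton
  have h1 := pd_mul hO contDiffOn_norm (contDiffOn_norm.pd hO j) i hx
  have h2 : EqOn (fun y : Euc n => ‖y‖ * pd j (fun y : Euc n => ‖y‖) y) (fun y => y j) {0}ᶜ :=
    fun y hy => by
      have : ‖y‖ ≠ 0 := norm_ne_zero_iff.mpr hy
      simp only
      rw [pd_norm hy]
      field_simp
  rw [pd_congr hO h2 i hx, pd_coord] at h1
  have : ‖x‖ ≠ 0 := norm_ne_zero_iff.mpr hx
  simp only [pd_norm hx] at h1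
  rw [eq_div_iff this, h1]
  ring

/-- The operator `w ↦ Bⁱʲ w_ij - qⁱ w_i`. -/
def ellOp (B : Matrix (Fin n) (Fin n) ℝ) (q : Fin n → ℝ) (w : Euc n → ℝ) (x : Euc n) : ℝ :=
  ∑ i, ∑ j, B i j * pd i (pd j w) x - ∑ i, q i * pd i w x

variable (B : Matrix (Fin n) (Fin n) ℝ) (q : Fin n → ℝ)

theorem ellOp_congr (hO : IsOpen O) (h : EqOn v w O) (hx : x ∈ O) :
    ellOp B q v x = ellOp B q w x := by
  simp only [ellOp, pd_congr hO h _ hx, pd_congr hO (pd_congr hO h _) _ hx]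

theorem ellOp_add (hO : IsOpen O) (hv : ContDiffOn ℝ (⊤ : ℕ∞) v O)
    (hw : ContDiffOn ℝ (⊤ : ℕ∞) w O) (hx : x ∈ O) :
    ellOp B q (fun y => v y + w y) x = ellOp B q v x + ellOp B q w x := by
  have h2 : ∀ i j, pd i (pd j fun y => v y + w y) x = pd i (pd j v) x + pd i (pd j w) x :=
    fun i j => (pd_congr hO (pd_add hO hv hw j) i hx).trans
      (pd_add hO (hv.pd hO j) (hw.pd hO j) i hx)
  simp only [ellOp, pd_add hO hv hw _ hx, h2, mul_add, Finset.sum_add_distrib]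
  ring

theorem ellOp_sub (hO : IsOpen O) (hv : ContDiffOn ℝ (⊤ : ℕ∞) v O)
    (hw : ContDiffOn ℝ (⊤ : ℕ∞) w O) (hx : x ∈ O) :
    ellOp B q (fun y => v y - w y) x = ellOp B q v x - ellOp B q w x := by
  have h2 : ∀ i j, pd i (pd j fun y => v y - w y) x = pd i (pd j v) x - pd i (pd j w) x :=
    fun i j => (pd_congr hO (pd_sub hO hv hw j) i hx).trans
      (pd_sub hO (hv.pd hO j) (hw.pd hO j) i hx)
  simp only [ellOp, pd_sub hO hv hw _ hx, h2, mul_sub, Finset.sum_sub_distrib]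
  ring

theorem ellOp_const (c : ℝ) : ellOp B q (fun _ => c) x = 0 := by
  simp [ellOp, pd_const]

theorem ellOp_mul (hO : IsOpen O) (hv : ContDiffOn ℝ (⊤ : ℕ∞) v O)
    (hw : ContDiffOn ℝ (⊤ : ℕ∞) w O) (hB : ∀ i j, B i j = B j i) (hx : x ∈ O) :
    ellOp B q (fun y => v y * w y) x = v x * ellOp B q w x + w x * ellOp B q v x
      + 2 * ∑ i, ∑ j, B i j * (pd i v x * pd j w x) := by
  have h2 : ∀ i j, pd i (pd j fun y => v y * w y) x =
      v x * pd i (pd j w) x + w x * pd i (pd j v) x + (pd i v x * pd j w x + pd j v x * pd i w x) :=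
    fun i j => by
      rw [pd_congr hO (pd_mul hO hv hw j) i hx,
        pd_add hO (hv.mul (hw.pd hO j)) (hw.mul (hv.pd hO j)) i hx]
      simp only
      rw [pd_mul hO hv (hw.pd hO j) i hx, pd_mul hO hw (hv.pd hO j) i hx]
      ring
  have hsym : ∑ i, ∑ j, B i j * (pd j v x * pd i w x) = ∑ i, ∑ j, B i j * (pd i v x * pd j w x) := by
    rw [Finset.sum_comm]
    exact Finset.sum_congr rfl fun i _ => Finset.sum_congr rfl fun j _ => by rw [hB]
  have e1 : ∑ i, ∑ j, B i j * pd i (pd j fun y => v y * w y) x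
      = v x * ∑ i, ∑ j, B i j * pd i (pd j w) x + w x * ∑ i, ∑ j, B i j * pd i (pd j v) x
        + 2 * ∑ i, ∑ j, B i j * (pd i v x * pd j w x) := by
    have h3 : ∑ i, ∑ j, B i j * pd i (pd j fun y => v y * w y) x
        = v x * ∑ i, ∑ j, B i j * pd i (pd j w) x + w x * ∑ i, ∑ j, B i j * pd i (pd j v) x
        + (∑ i, ∑ j, B i j * (pd i v x * pd j w x) + ∑ i, ∑ j, B i j * (pd j v x * pd i w x)) := by
      simp only [h2, mul_add, Finset.sum_add_distrib, Finset.mul_sum]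
      simp only [mul_left_comm]
    rw [h3, hsym]
    ring
  have e2 : ∑ i, q i * pd i (fun y => v y * w y) x
      = v x * ∑ i, q i * pd i w x + w x * ∑ i, q i * pd i v x := by
    rw [Finset.mul_sum, Finset.mul_sum, ← Finset.sum_add_distrib]
    refine Finset.sum_congr rfl fun i _ => ?_
    rw [pd_mul hO hv hw i hx]
    ring
  rw [ellOp, e1, e2, ellOp, ellOp]
  ring

theorem ellOp_const_mul (hO : IsOpen O) (hw : ContDiffOn ℝ (⊤ : ℕ∞) w O) (c : ℝ) (hx : x ∈ O) :
    ellOp B q (fun y => c * w y) x = c * ellOp B q w x := by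
  have h1 : ∀ (u : Euc n → ℝ), ContDiffOn ℝ (⊤ : ℕ∞) u O → ∀ i,
      EqOn (pd i fun y => c * u y) (fun y => c * pd i u y) O := fun u hu i y hy => by
    rw [pd_mul hO contDiffOn_const hu i hy]
    simp [pd_const]
  have h2 : ∀ i j, pd i (pd j fun y => c * w y) x = c * pd i (pd j w) x :=
    fun i j => (pd_congr hO (h1 w hw j) i hx).trans (h1 _ (hw.pd hO j) i hx)
  simp only [ellOp, h1 w hw _ hx, h2, mul_sub, Finset.mul_sum]
  simp only [mul_left_comm]

end Partial

theorem Llin_eq_ellOp {n : ℕ} {Ω O : Set (Euc n)} {u w : Euc n → ℝ} {x : Euc n}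
    (hO : IsOpen O) (hOΩ : O ⊆ Ω)
    (hw : ContDiffOn ℝ (⊤ : ℕ∞) w O) (hx : x ∈ O) :
    Llin Ω u w x = ellOp (Hess u x)⁻¹
      (fun i => ((n : ℝ) + 2) / (1 + ‖fderiv ℝ u x‖ ^ 2) * pd i u x) w x := by
  have hΩ : Ω ∈ 𝓝 x := mem_of_superset (hO.mem_nhds hx) hOΩ
  have h1 : ∀ (g : Euc n → ℝ) i, pdW Ω g x i = pd i g x := fun g i => by
    rw [pdW, fderivWithin_of_mem_nhds hΩ, pd]
  have h2 : ∀ g : Euc n → ℝ, HessW Ω g x = Hess g x := fun g => by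
    ext i j
    have : Ω =ᶠ[𝓝 x] univ := by simpa using hΩ
    rw [HessW, iteratedFDerivWithin_congr_set this, iteratedFDerivWithin_univ, Hess]
  simp only [Llin, h1, h2, ellOp, Hess_apply hO hw hx, ← norm_sq_fderiv, Finset.mul_sum, mul_assoc]

section Segments

variable {n : ℕ} {O Ω : Set (Euc n)} {w : Euc n → ℝ} {x v : Euc n}

theorem hasDerivAt_comp_segment (hO : IsOpen O) (hw : ContDiffOn ℝ (⊤ : ℕ∞) w O) {s : ℝ}
    (hs : x + s • v ∈ O) :
    HasDerivAt (fun s : ℝ => w (x + s • v)) (∑ i, v i * pd i w (x + s • v)) s := by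
  have h1 : HasDerivAt (fun s : ℝ => x + s • v) v s := by
    simpa using ((hasDerivAt_id s).smul_const v).const_add x
  have h2 := (hw.differentiableAt_of_isOpen hO hs).hasFDerivAt.comp_hasDerivAt s h1
  rwa [clm_apply_eq_sum] at h2

theorem hasDerivAt_sum_pd_segment (hO : IsOpen O) (hw : ContDiffOn ℝ (⊤ : ℕ∞) w O) {s : ℝ}
    (hs : x + s • v ∈ O) :
    HasDerivAt (fun s : ℝ => ∑ i, v i * pd i w (x + s • v))
      (∑ i, ∑ j, v i * v j * pd i (pd j w) (x + s • v)) s := by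
  rw [Finset.sum_comm]
  refine HasDerivAt.fun_sum fun j _ => ?_
  refine ((hasDerivAt_comp_segment hO (hw.pd hO j) hs).const_mul (v j)).congr_deriv ?_
  rw [Finset.mul_sum]
  exact Finset.sum_congr rfl fun i _ => by ring

theorem convexOn_segment (hO : IsOpen O) (hw : ContDiffOn ℝ (⊤ : ℕ∞) w O) {L κ : ℝ}
    (hc : ContinuousOn (fun s : ℝ => w (x + s • v)) (Icc 0 L))
    (hin : ∀ s ∈ Ioo 0 L, x + s • v ∈ O)
    (hpos : ∀ s ∈ Ioo 0 L, 0 ≤ ∑ i, ∑ j, v i * v j * pd i (pd j w) (x + s • v) + κ) :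
    ConvexOn ℝ (Icc 0 L) (fun s : ℝ => w (x + s • v) + κ / 2 * s ^ 2) := by
  refine convexOn_of_hasDerivWithinAt2_nonneg (convex_Icc 0 L)
    (f' := fun s => ∑ i, v i * pd i w (x + s • v) + κ * s)
    (f'' := fun s => ∑ i, ∑ j, v i * v j * pd i (pd j w) (x + s • v) + κ)
    (hc.add (by fun_prop)) ?_ ?_ ?_
  · intro s hs
    rw [interior_Icc] at hs
    refine ((hasDerivAt_comp_segment hO hw (hin s hs)).add ?_).hasDerivWithinAt
    refine ((hasDerivAt_pow 2 s).const_mul (κ / 2)).congr_deriv ?_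
    simp
    ring
  · intro s hs
    rw [interior_Icc] at hs
    refine ((hasDerivAt_sum_pd_segment hO hw (hin s hs)).add ?_).hasDerivWithinAt
    simpa using (hasDerivAt_id s).const_mul κ
  · intro s hs
    rw [interior_Icc] at hs
    exact hpos s hs

/-- A lower Hessian bound `D²w ≥ -κ` along a chord bounds the derivative at its initial point by
the difference quotient. -/
theorem fderivWithin_apply_le_of_chord (hO : IsOpen O) (hOΩ : O ⊆ Ω)
    (hw : ContDiffOn ℝ (⊤ : ℕ∞) w O) (hcw : ContinuousOn w Ω) {D : Euc n →L[ℝ] ℝ}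
    (hD : HasFDerivWithinAt w D Ω x) {L κ : ℝ} (hL : 0 < L) (hx : x ∈ Ω) (hxL : x + L • v ∈ Ω)
    (hin : ∀ s ∈ Ioo 0 L, x + s • v ∈ O)
    (hpos : ∀ s ∈ Ioo 0 L, 0 ≤ ∑ i, ∑ j, v i * v j * pd i (pd j w) (x + s • v) + κ) :
    D v ≤ (w (x + L • v) - w x) / L + κ * L / 2 := by
  have hmaps : MapsTo (fun s : ℝ => x + s • v) (Icc 0 L) Ω := by
    intro s hs
    rcases hs.1.eq_or_lt with rfl | h0
    · simpa using hx
    rcases hs.2.eq_or_lt with rfl | h1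
    · exact hxL
    · exact hOΩ (hin s ⟨h0, h1⟩)
  have hcv := convexOn_segment hO hw (hcw.comp (by fun_prop) hmaps) hin hpos
  have h1 : HasDerivWithinAt (fun s : ℝ => x + s • v) v (Icc 0 L) 0 := by
    simpa using (((hasDerivAt_id (0 : ℝ)).smul_const v).const_add x).hasDerivWithinAt
  have hd : HasDerivWithinAt (fun s : ℝ => w (x + s • v) + κ / 2 * s ^ 2) (D v) (Icc 0 L) 0 := by
    have h2 : HasFDerivWithinAt w D Ω (x + (0 : ℝ) • v) := by simpa using hD
    have h3 := h2.comp_hasDerivWithinAt (0 : ℝ) h1 hmaps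
    have h4 : HasDerivWithinAt (fun s : ℝ => κ / 2 * s ^ 2) 0 (Icc 0 L) 0 := by
      simpa using ((hasDerivAt_pow 2 (0 : ℝ)).const_mul (κ / 2)).hasDerivWithinAt
    exact (h3.add h4).congr_deriv (add_zero _)
  have := hcv.le_slope_of_hasDerivWithinAt (left_mem_Icc.mpr hL.le) (right_mem_Icc.mpr hL.le)
    hL hd
  rw [slope_def_field] at this
  refine this.trans (le_of_eq ?_)
  simp
  field_simp
  ring

theorem IsLocalMin.sum_pd_pd_nonneg (hO : IsOpen O) (hw : ContDiffOn ℝ (⊤ : ℕ∞) w O)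
    (hx : x ∈ O) (hmin : IsLocalMin w x) (v : Fin n → ℝ) :
    0 ≤ ∑ i, ∑ j, v i * v j * pd i (pd j w) x := by
  set V : Euc n := WithLp.toLp 2 v
  set g : ℝ → ℝ := fun s => w (x + s • V) with hg
  have hcx : ContinuousAt (fun s : ℝ => x + s • V) 0 := by fun_prop
  have hev : ∀ᶠ s : ℝ in 𝓝 0, x + s • V ∈ O := hcx (by simpa using hO.mem_nhds hx)
  have hgmin : IsLocalMin g 0 := by
    have : ∀ᶠ s : ℝ in 𝓝 0, w x ≤ w (x + s • V) := hcx (by simpa [IsLocalMin, IsMinFilter, Filter.Eventually] using hmin)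
    filter_upwards [this] with s hs
    simpa [hg] using hs
  have hd1 : deriv g =ᶠ[𝓝 0] fun s => ∑ i, V i * pd i w (x + s • V) := by
    filter_upwards [hev] with s hs using (hasDerivAt_comp_segment hO hw hs).deriv
  have h0 : x + (0 : ℝ) • V ∈ O := by simpa using hx
  have hd2 : deriv (deriv g) 0 = ∑ i, ∑ j, v i * v j * pd i (pd j w) x := by
    rw [hd1.deriv_eq, (hasDerivAt_sum_pd_segment hO hw h0).deriv]
    simp [V]
  rw [← hd2]
  by_contra hneg
  have hgmax : IsLocalMax g 0 := isLocalMax_of_deriv_deriv_neg (not_le.mp hneg) hgmin.deriv_eq_zero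
    (hasDerivAt_comp_segment hO hw h0).continuousAt
  have hconst : g =ᶠ[𝓝 0] fun _ => g 0 := by
    filter_upwards [hgmin, hgmax] with s h1 h2 using le_antisymm h2 h1
  have : deriv (deriv g) 0 = 0 := by
    rw [(hconst.deriv).deriv_eq]
    simp
  exact hneg this.ge

end Segments

theorem Matrix.PosDef.sum_inv_mul {n : ℕ} {A : Matrix (Fin n) (Fin n) ℝ} (hA : A.PosDef) :
    ∑ i, ∑ j, A⁻¹ i j * A i j = n := by
  have hs : ∀ i j, A i j = A j i := fun i j => by simpa using (hA.isHermitian.apply i j).symm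
  have h : A⁻¹ * A = 1 := Matrix.nonsing_inv_mul A hA.det_pos.ne'.isUnit
  have : ∀ i, ∑ j, A⁻¹ i j * A i j = 1 := fun i => by
    have := congrFun (congrFun h i) i
    rw [Matrix.mul_apply, Matrix.one_apply_eq] at this
    rw [← this]
    exact Finset.sum_congr rfl fun j _ => by rw [hs i j]
  simp [this]

theorem log_gaussK {n : ℕ} {u : Euc n → ℝ} {x : Euc n} (h : (Hess u x).PosDef) :
    Real.log (gaussK u x) = Real.log (Hess u x).det
      - ((n : ℝ) + 2) / 2 * Real.log (1 + ‖fderiv ℝ u x‖ ^ 2) := by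
  have : 0 < 1 + ‖fderiv ℝ u x‖ ^ 2 := by positivity
  rw [gaussK, Real.log_div h.det_pos.ne' (Real.rpow_pos_of_pos this _).ne', Real.log_rpow this]

theorem gaussK_pos {n : ℕ} {u : Euc n → ℝ} {x : Euc n} (h : (Hess u x).PosDef) :
    0 < gaussK u x :=
  div_pos h.det_pos (Real.rpow_pos_of_pos (by positivity) _)

theorem log_one_add_sq_sub_le {a b : ℝ} (hb : 0 ≤ b) (ha : 0 ≤ a) :
    Real.log (1 + a ^ 2) - Real.log (1 + b ^ 2) ≤ 2 * |a - b| := by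
  have hpa : 0 < 1 + a ^ 2 := by positivity
  have hpb : 0 < 1 + b ^ 2 := by positivity
  have hle : 1 + a ^ 2 ≤ (1 + b ^ 2) * (1 + |a - b|) ^ 2 := by
    have h1 : a ≤ b + |a - b| := by linarith [le_abs_self (a - b)]
    have h2 := abs_nonneg (a - b)
    nlinarith [mul_nonneg hb h2, mul_nonneg (sq_nonneg b) h2, sq_nonneg (b - 1),
      mul_nonneg (sq_nonneg (b - 1)) h2, mul_nonneg (sq_nonneg b) (sq_nonneg (|a - b|))]
  have h3 := Real.log_le_log hpa hle
  rw [Real.log_mul hpb.ne' (by positivity), Real.log_pow] at h3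
  have h4 := Real.log_le_sub_one_of_pos (by positivity : 0 < 1 + |a - b|)
  push_cast at h3
  linarith

theorem pd_mul_exp_coord {n : ℕ} (c l : ℝ) (k i : Fin n) :
    pd i (fun y : Euc n => c * Real.exp (l * y k))
      = fun y => (if i = k then c * l else 0) * Real.exp (l * y k) := by
  ext x
  have h1 : HasFDerivAt (fun y : Euc n => y k) (EuclideanSpace.proj k : Euc n →L[ℝ] ℝ) x :=
    (EuclideanSpace.proj k : Euc n →L[ℝ] ℝ).hasFDerivAt
  have h2 := ((h1.const_mul l).exp).const_mul c
  simp only [pd, h2.fderiv]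
  by_cases h : i = k
  · subst h
    simp
    ring
  · simp [h, Ne.symm h]

theorem continuousOn_inv_Hess {n : ℕ} {O : Set (Euc n)} {u : Euc n → ℝ} (hO : IsOpen O)
    (hu : ContDiffOn ℝ (⊤ : ℕ∞) u O) (hpd : ∀ x ∈ O, (Hess u x).PosDef) (i j : Fin n) :
    ContinuousOn (fun x => (Hess u x)⁻¹ i j) O := by
  have hH : ContinuousOn (fun x => Hess u x) O := by
    refine continuousOn_pi.mpr fun i => continuousOn_pi.mpr fun j => ?_
    exact ((hu.pd hO j).pd hO i).continuousOn.congr fun y hy => Hess_apply hO hu hy i j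
  have hadj : ContinuousOn (fun x => (Hess u x).adjugate i j) O := by
    have : Continuous fun A : Matrix (Fin n) (Fin n) ℝ => A.adjugate i j :=
      (continuous_id.matrix_adjugate).matrix_elem i j
    exact this.comp_continuousOn hH
  have hdet : ContinuousOn (fun x => (Hess u x).det) O :=
    (continuous_id.matrix_det).comp_continuousOn hH
  refine (hadj.div hdet fun x hx => (hpd x hx).det_pos.ne').congr fun x hx => ?_
  simp only [Matrix.inv_def, Matrix.smul_apply, Ring.inverse_eq_inv', smul_eq_mul]
  rw [Pi.div_apply, div_eq_inv_mul]

section Comparison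

variable {n : ℕ} (S : ExtSetting n) {R : ℝ} {u : Euc n → ℝ}

theorem isOpen_ball_diff_K (R : ℝ) : IsOpen (ball (0 : Euc n) R \ S.K) :=
  isOpen_ball.sdiff S.hKc.isClosed

theorem ball_diff_K_subset_solDom (R : ℝ) : ball (0 : Euc n) R \ S.K ⊆ solDom S R :=
  fun _ hy => ⟨ball_subset_closedBall hy.1, fun h => hy.2 (interior_subset h)⟩

theorem solDom_subset_compl_interior (R : ℝ) : solDom S R ⊆ (interior S.K)ᶜ := fun _ hy => hy.2

theorem K_subset_union_frontier : S.K ⊆ interior S.K ∪ frontier S.K := fun x hx => by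
  by_cases h : x ∈ interior S.K
  · exact Or.inl h
  · exact Or.inr ⟨subset_closure hx, h⟩

theorem ul_contDiffOn_ball_diff_K (R : ℝ) :
    ContDiffOn ℝ (⊤ : ℕ∞) S.ul (ball (0 : Euc n) R \ S.K) :=
  S.hulsm.mono ((ball_diff_K_subset_solDom S R).trans (solDom_subset_compl_interior S R))

theorem IsSol.contDiffOn_ball_diff_K (hu : IsSol S R u) :
    ContDiffOn ℝ (⊤ : ℕ∞) u (ball (0 : Euc n) R \ S.K) :=
  hu.1.mono (ball_diff_K_subset_solDom S R)

/-- The comparison principle `u̲ ≤ u`. -/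
theorem IsSol.ul_le (hu : IsSol S R u) : ∀ x ∈ solDom S R, S.ul x ≤ u x := by
  obtain ⟨husm, hconv, heq, hbc⟩ := id hu
  set Ω := solDom S R with hΩ
  set O := ball (0 : Euc n) R \ S.K with hOdef
  have hO : IsOpen O := isOpen_ball_diff_K S R
  have hOΩ : O ⊆ Ω := ball_diff_K_subset_solDom S R
  have huO : ContDiffOn ℝ (⊤ : ℕ∞) u O := husm.mono hOΩ
  have hlO : ContDiffOn ℝ (⊤ : ℕ∞) S.ul O := ul_contDiffOn_ball_diff_K S R
  by_contra! hcon
  obtain ⟨z, hz, hzlt⟩ := hcon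
  have hΩc : IsCompact Ω := (isCompact_closedBall _ _).diff isOpen_interior
  set w : Euc n → ℝ := fun y => u y - S.ul y with hw
  have hwc : ContinuousOn w Ω := husm.continuousOn.sub
    (S.hulsm.continuousOn.mono (solDom_subset_compl_interior S R))
  set μ : ℝ := -w z with hμ
  have hμpos : 0 < μ := by simp only [hμ, hw]; linarith
  have hneg : ∀ y ∈ Ω, w y < 0 → y ∈ O := by
    intro y hy hwy
    have hnb : y ∉ sphere (0 : Euc n) R ∪ frontier S.K := fun hb => by
      have := hbc y hb
      simp only [hw] at hwy
      linarith
    refine ⟨?_, fun hK => ?_⟩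
    · have h1 : dist y 0 ≤ R := hy.1
      exact lt_of_le_of_ne h1 fun h => hnb (Or.inl h)
    · rcases K_subset_union_frontier S hK with h | h
      · exact hy.2 h
      · exact hnb (Or.inr h)
  have hZc : IsCompact {y ∈ Ω | w y ≤ -μ / 2} := by
    have := hwc.preimage_isClosed_of_isClosed hΩc.isClosed (isClosed_Iic (a := -μ / 2))
    exact hΩc.of_isClosed_subset this fun y hy => hy.1
  have hZO : {y ∈ Ω | w y ≤ -μ / 2} ⊆ O := fun y hy => hneg y hy.1 (by
    have := hy.2
    linarith)
  have hzZ : z ∈ {y ∈ Ω | w y ≤ -μ / 2} := ⟨hz, by simp only [hμ]; linarith⟩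
  set k : Fin n := ⟨0, by have := S.hn; omega⟩ with hk
  obtain ⟨z₀, hz₀, hmin₀⟩ := hZc.exists_isMinOn ⟨z, hzZ⟩
    ((continuousOn_inv_Hess hO huO hconv k k).mono hZO)
  set c := (Hess u z₀)⁻¹ k k with hc
  have : Nonempty (Fin n) := ⟨k⟩
  have hcpos : 0 < c := (hconv z₀ (hZO hz₀)).inv.diag_pos
  set l : ℝ := (n + 3) / c with hl
  have hlpos : 0 < l := by positivity
  set ε : ℝ := μ / 2 / Real.exp (l * R) with hε
  have hεpos : 0 < ε := by positivity
  set φ : Euc n → ℝ := fun y => ε * Real.exp (l * y k) with hφ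
  have hφsm : ContDiffOn ℝ (⊤ : ℕ∞) φ O := by
    have : ContDiff ℝ (⊤ : ℕ∞) φ :=
      contDiff_const.mul ((contDiff_const.mul
        (EuclideanSpace.proj k : Euc n →L[ℝ] ℝ).contDiff).exp)
    exact this.contDiffOn
  have hφpos : ∀ y, 0 < φ y := fun y => by positivity
  have hφle : ∀ y ∈ Ω, φ y ≤ μ / 2 := fun y hy => by
    have h1 : ‖y‖ ≤ R := by simpa using hy.1
    have h2 : y k ≤ R := ((le_abs_self _).trans (PiLp.norm_apply_le y k)).trans h1
    have h3 : Real.exp (l * y k) ≤ Real.exp (l * R) := by gcongr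
    calc φ y ≤ ε * Real.exp (l * R) := by simp only [hφ]; gcongr
      _ = μ / 2 := by rw [hε]; field_simp
  obtain ⟨y, hy, hymin⟩ := hΩc.exists_isMinOn ⟨z, hz⟩
    (hwc.sub (by fun_prop : ContinuousOn φ Ω))
  have hyZ : y ∈ {y ∈ Ω | w y ≤ -μ / 2} := by
    refine ⟨hy, ?_⟩
    have h1 : w y - φ y ≤ w z - φ z := hymin hz
    have h2 := hφle y hy
    have h3 := hφpos z
    simp only [hμ] at *
    linarith
  have hyO : y ∈ O := hZO hyZ
  have hylt : u y ≤ S.ul y := by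
    have h1 := hyZ.2
    simp only [hw] at h1
    linarith
  have hlm : IsLocalMin (fun y => w y - φ y) y :=
    hymin.isLocalMin (mem_of_superset (hO.mem_nhds hyO) hOΩ)
  have hwO : ContDiffOn ℝ (⊤ : ℕ∞) w O := huO.sub hlO
  have hgrad : ∀ i, pd i u y - pd i S.ul y = pd i φ y := fun i => by
    have h1 : pd i (fun y => w y - φ y) y = 0 := by
      simp [pd, hlm.fderiv_eq_zero]
    rw [pd_sub hO hwO hφsm i hyO] at h1
    simp only [hw] at h1
    rw [pd_sub hO huO hlO i hyO] at h1
    linarith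
  have hPu := hconv y hyO
  have hPl := S.hulconv y hyO.2
  have hhess := hPu.inv.posSemidef.sum_mul_nonneg
    (hlm.sum_pd_pd_nonneg hO (hwO.sub hφsm) hyO)
  set B := (Hess u y)⁻¹ with hB
  have e0 : ∀ g : Euc n → ℝ, ∑ i, ∑ j, B i j * pd i (pd j g) y = ellOp B 0 g y := fun g => by
    simp [ellOp]
  have eφ : ellOp B 0 φ y = B k k * (l ^ 2 * φ y) := by
    rw [← e0, hφ]
    simp only [pd_mul_exp_coord]
    simp
    left
    ring
  have eu : ellOp B 0 u y = n := by
    rw [← e0, ← hPu.sum_inv_mul]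
    simp only [Hess_apply hO huO hyO, hB]
  have el : n + Real.log (Hess S.ul y).det - Real.log (Hess u y).det ≤ ellOp B 0 S.ul y := by
    rw [← e0]
    simp only [← Hess_apply hO hlO hyO]
    exact hPu.log_det_le hPl
  rw [e0, ellOp_sub B 0 hO hwO hφsm hyO, ellOp_sub B 0 hO huO hlO hyO, eφ, eu] at hhess
  have hK : gaussK u y ≤ gaussK S.ul y := by
    rw [heq y hyO]
    exact (S.hfz y (solDom_subset_compl_interior S R hy) hylt).trans (S.hulsub y hyO.2)
  have hlogK := Real.log_le_log (gaussK_pos hPu) hK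
  rw [log_gaussK hPu, log_gaussK hPl] at hlogK
  have hnorm : ‖fderiv ℝ u y - fderiv ℝ S.ul y‖ = l * φ y := by
    have h1 : ‖fderiv ℝ u y - fderiv ℝ S.ul y‖ ^ 2 = (l * φ y) ^ 2 := by
      rw [norm_sq_clm]
      have : ∀ i, (fderiv ℝ u y - fderiv ℝ S.ul y) (EuclideanSpace.single i 1) = pd i φ y :=
        fun i => (hgrad i)
      simp only [this, hφ, pd_mul_exp_coord]
      simp [ite_pow]
      ring
    have h2 : 0 ≤ l * φ y := mul_nonneg hlpos.le (hφpos y).le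
    exact (sq_eq_sq₀ (norm_nonneg _) h2).mp h1
  have hlog := log_one_add_sq_sub_le (norm_nonneg (fderiv ℝ S.ul y)) (norm_nonneg (fderiv ℝ u y))
  have hsub := abs_norm_sub_norm_le (fderiv ℝ u y) (fderiv ℝ S.ul y)
  rw [hnorm] at hsub
  have hck : c ≤ B k k := hmin₀ hyZ
  have hcl : c * l = n + 3 := by rw [hl]; field_simp
  have h1 : (n + 3) * (l * φ y) ≤ B k k * (l ^ 2 * φ y) := by
    calc (n + 3) * (l * φ y) = c * (l ^ 2 * φ y) := by rw [← hcl]; ring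
      _ ≤ _ := by gcongr
  have h2 : ((n : ℝ) + 2) / 2 * (Real.log (1 + ‖fderiv ℝ u y‖ ^ 2)
      - Real.log (1 + ‖fderiv ℝ S.ul y‖ ^ 2)) ≤ (n + 2) * (l * φ y) := by
    calc _ ≤ ((n : ℝ) + 2) / 2 * (2 * (l * φ y)) := by
          gcongr
          linarith
      _ = _ := by ring
  have h3 : 0 < l * φ y := mul_pos hlpos (hφpos y)
  linarith

/-- A point of `∂K` on the ray through `q`, beyond which the ray does not meet `K`. -/
theorem exists_last_mem_frontier {q : Euc n} (hq : S.R₀ ≤ ‖q‖) :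
    ∃ a : ℝ, 0 ≤ a ∧ a < 1 ∧ a * ‖q‖ < S.R₀ ∧ a • q ∈ frontier S.K ∧
      ∀ s, a < s → s ≤ 1 → s • q ∉ S.K := by
  have hcl : IsClosed ((fun s : ℝ => s • q) ⁻¹' S.K) :=
    S.hKc.isClosed.preimage (by fun_prop)
  have hT : IsCompact (Icc (0 : ℝ) 1 ∩ (fun s : ℝ => s • q) ⁻¹' S.K) :=
    isCompact_Icc.inter_right hcl
  obtain ⟨a, ha, hmax⟩ := hT.exists_isGreatest
    ⟨0, ⟨le_rfl, zero_le_one⟩, by simpa using interior_subset S.hK0⟩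
  have hlast : ∀ s, a < s → s ≤ 1 → s • q ∉ S.K := fun s h1 h2 h3 =>
    absurd (hmax ⟨⟨ha.1.1.trans h1.le, h2⟩, h3⟩) (not_le.mpr h1)
  have hnorm : a * ‖q‖ < S.R₀ := by
    have := S.hKR₀ ha.2
    rwa [mem_ball_zero_iff, norm_smul, Real.norm_of_nonneg ha.1.1] at this
  have ha1 : a < 1 := by
    refine lt_of_le_of_ne ha.1.2 fun h => ?_
    rw [h] at hnorm
    linarith
  refine ⟨a, ha.1.1, ha1, hnorm, ⟨subset_closure ha.2, fun hint => ?_⟩, hlast⟩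
  have hc : ContinuousAt (fun s : ℝ => s • q) a := by fun_prop
  have h1 : ∀ᶠ s in 𝓝[>] a, s • q ∈ interior S.K :=
    nhdsWithin_le_nhds (hc (isOpen_interior.mem_nhds hint))
  obtain ⟨s, hs, hs1⟩ := (h1.and (Ioo_mem_nhdsGT ha1)).exists
  exact hlast s hs1.1 hs1.2.le (interior_subset hs)

theorem IsSol.sum_pd_pd_nonneg (hu : IsSol S R u) {x : Euc n} (hx : x ∈ ball (0 : Euc n) R \ S.K)
    (v : Fin n → ℝ) : 0 ≤ ∑ i, ∑ j, v i * v j * pd i (pd j u) x := by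
  have h := (hu.2.1 x hx).posSemidef.dotProduct_mulVec_nonneg v
  simp only [dotProduct, Matrix.mulVec, star_trivial, Finset.mul_sum] at h
  refine h.trans (le_of_eq (Finset.sum_congr rfl fun i _ => Finset.sum_congr rfl fun j _ => ?_))
  rw [Hess_apply (isOpen_ball_diff_K S R) hu.contDiffOn_ball_diff_K hx]
  ring

theorem IsSol.le_norm_add (hu : IsSol S R u) {C : ℝ}
    (hC : ∀ x ∈ (interior S.K)ᶜ, |S.ul x - ‖x‖| ≤ C) {x : Euc n} (hx0 : S.R₀ ≤ ‖x‖)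
    (hxR : ‖x‖ ≤ R) : u x ≤ ‖x‖ + C := by
  have hxpos : 0 < ‖x‖ := S.hR₀.trans_le hx0
  have hRpos : 0 < R := hxpos.trans_le hxR
  set q : Euc n := (R / ‖x‖) • x with hq
  have hqn : ‖q‖ = R := by
    rw [hq, norm_smul, Real.norm_of_nonneg (by positivity)]
    field_simp
  obtain ⟨a, ha0, ha1, haq, haK, hlast⟩ := exists_last_mem_frontier S (hqn.symm ▸ hx0.trans hxR)
  rw [hqn] at haq
  set L := 1 - a with hL
  have hLpos : 0 < L := by simp only [hL]; linarith
  have hpt : ∀ s : ℝ, a • q + s • q = (a + s) • q := fun s => (add_smul _ _ _).symm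
  have hin : ∀ s ∈ Ioo 0 L, a • q + s • q ∈ ball (0 : Euc n) R \ S.K := fun s hs => by
    rw [hpt]
    have h1 : a + s < 1 := by have := hs.2; simp only [hL] at this; linarith
    refine ⟨?_, hlast _ (by linarith [hs.1]) h1.le⟩
    rw [mem_ball_zero_iff, norm_smul, hqn, Real.norm_of_nonneg (by linarith [hs.1])]
    nlinarith
  have hqΩ : q ∈ solDom S R := by
    refine ⟨by simp [hqn], fun h => ?_⟩
    have := S.hKR₀ (interior_subset h)
    rw [mem_ball_zero_iff, hqn] at this
    linarith
  have haΩ : a • q ∈ solDom S R := by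
    refine ⟨?_, haK.2⟩
    rw [mem_closedBall_zero_iff, norm_smul, hqn, Real.norm_of_nonneg ha0]
    linarith
  have hc : ContinuousOn (fun s : ℝ => u (a • q + s • q)) (Icc 0 L) := by
    refine hu.1.continuousOn.comp (by fun_prop) fun s hs => ?_
    rcases hs.1.eq_or_lt with rfl | h0
    · simpa using haΩ
    rcases hs.2.eq_or_lt with rfl | h1
    · simp only [hpt, hL]
      simpa using hqΩ
    · exact ball_diff_K_subset_solDom S R (hin s ⟨h0, h1⟩)
  have hcv := convexOn_segment (κ := 0) (isOpen_ball_diff_K S R) hu.contDiffOn_ball_diff_K hc hin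
    (fun s hs => by simpa using hu.sum_pd_pd_nonneg S (hin s hs) q)
  simp only [zero_div, zero_mul, add_zero] at hcv
  have hb0 : u (a • q) ≤ a * R + C := by
    rw [hu.2.2.2 _ (Or.inr haK)]
    have := (abs_le.mp (hC _ haΩ.2)).2
    rw [norm_smul, hqn, Real.norm_of_nonneg ha0] at this
    linarith
  have hb1 : u q ≤ R + C := by
    rw [hu.2.2.2 _ (Or.inl (by simp [hqn]))]
    have := (abs_le.mp (hC _ hqΩ.2)).2
    rw [hqn] at this
    linarith
  set θ := (‖x‖ / R - a) / L with hθ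
  have hθL : θ * L = ‖x‖ / R - a := by rw [hθ]; field_simp
  have hxa : a < ‖x‖ / R := by rw [lt_div_iff₀ hRpos]; linarith
  have hx1 : ‖x‖ / R ≤ 1 := by rw [div_le_one hRpos]; exact hxR
  have hθ0 : 0 ≤ θ := div_nonneg (by linarith) hLpos.le
  have hθ1 : θ ≤ 1 := by rw [hθ, div_le_one hLpos]; linarith
  have key := hcv.2 (left_mem_Icc.mpr hLpos.le) (right_mem_Icc.mpr hLpos.le)
    (sub_nonneg.mpr hθ1) hθ0 (by ring)
  simp only [smul_eq_mul, mul_zero, zero_add, hθL, hpt, zero_smul, add_zero] at key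
  have hxq : (a + (‖x‖ / R - a)) • q = x := by
    rw [hq, smul_smul]
    have : (a + (‖x‖ / R - a)) * (R / ‖x‖) = 1 := by field_simp; ring
    rw [this, one_smul]
  have hq1 : (a + L) • q = q := by simp [hL]
  rw [hxq, hq1] at key
  calc u x ≤ (1 - θ) * u (a • q) + θ * u q := key
    _ ≤ (1 - θ) * (a * R + C) + θ * (R + C) := by
        gcongr
    _ = (a + θ * L) * R + C := by simp only [hL]; ring
    _ = ‖x‖ + C := by rw [hθL]; field_simp; ring

end Comparison

section FarField

variable {n : ℕ}

/-- The decay bounds of the setting with common constants. -/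
structure FarBound (S : ExtSetting n) (C R₁ : ℝ) : Prop where
  one_le : 1 ≤ C
  one_le_radius : 1 ≤ R₁
  R₀_lt : S.R₀ < R₁
  abs_sub_le : ∀ x ∈ (interior S.K)ᶜ, |S.ul x - ‖x‖| ≤ C
  norm_fderiv_le : ∀ x, R₁ ≤ ‖x‖ → ‖fderiv ℝ S.ul x‖ ≤ C
  abs_pd_pd_sub_le : ∀ x : Euc n, R₁ ≤ ‖x‖ → ∀ i j,
    |pd i (pd j S.ul) x - ((if i = j then 1 else 0) - x i / ‖x‖ * (x j / ‖x‖)) / ‖x‖|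
      ≤ C / ‖x‖ ^ 2
  abs_pd_pd_le : ∀ x : Euc n, R₁ ≤ ‖x‖ → ∀ i j, |pd i (pd j S.ul) x| ≤ C / ‖x‖
  abs_pd_pd_pd_le : ∀ x : Euc n, R₁ ≤ ‖x‖ → ∀ i j k, |pd i (pd j (pd k S.ul)) x| ≤ C / ‖x‖ ^ 2
  f_mul_le : ∀ x ∈ (interior S.K)ᶜ, ∀ z, S.f x z * ‖x‖ ^ (n + 1) ≤ C
  norm_fderiv_f_le : ∀ x ∈ S.Kᶜ, ∀ z,
    ‖fderiv ℝ (fun p : Euc n × ℝ => S.f p.1 p.2) (x, z)‖ ≤ C * S.f x z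

theorem abs_apply_div_norm_le (x : Euc n) (i : Fin n) : |x i / ‖x‖| ≤ 1 := by
  rw [abs_div, abs_norm]
  exact div_le_one_of_le₀ (PiLp.norm_apply_le x i) (norm_nonneg _)

theorem compl_K_subset_compl_interior (S : ExtSetting n) : S.Kᶜ ⊆ (interior S.K)ᶜ :=
  compl_subset_compl.mpr interior_subset

theorem notMem_K_of_le_norm (S : ExtSetting n) {x : Euc n} (hx : S.R₀ ≤ ‖x‖) : x ∉ S.K :=
  fun h => (not_lt.mpr hx) (by simpa using S.hKR₀ h)

theorem exists_farBound (S : ExtSetting n) : ∃ C R₁, FarBound S C R₁ := by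
  obtain ⟨C₀, h0⟩ := S.hulcone
  obtain ⟨C₁, r₁, h1⟩ := S.huldec1
  obtain ⟨C₂, r₂, h2⟩ := S.huldec2
  obtain ⟨C₃, h3⟩ := S.hfdec
  obtain ⟨C₄, h4⟩ := S.hfder
  set O : Set (Euc n) := (closedBall 0 S.R₀)ᶜ with hOdef
  have hO : IsOpen O := isClosed_closedBall.isOpen_compl
  have hmemO : ∀ x : Euc n, x ∈ O ↔ S.R₀ < ‖x‖ := fun x => by simp [hOdef]
  have hulO : ContDiffOn ℝ (⊤ : ℕ∞) S.ul O := S.hulsm.mono fun x hx =>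
    compl_K_subset_compl_interior S (notMem_K_of_le_norm S ((hmemO x).mp hx).le)
  have hO0 : O ⊆ {0}ᶜ := fun x hx h => by
    rw [mem_singleton_iff] at h
    have := (hmemO x).mp hx
    rw [h, norm_zero] at this
    exact (this.trans S.hR₀).false
  have hnO : ContDiffOn ℝ (⊤ : ℕ∞) (fun y : Euc n => ‖y‖) O := contDiffOn_norm.mono hO0
  set M := max 1 (max |C₀| (max |C₁| (max |C₂| (max |C₃| |C₄|)))) with hM
  have hM1 : 1 ≤ M := le_max_left _ _
  have hM2 : max |C₀| (max |C₁| (max |C₂| (max |C₃| |C₄|))) ≤ M := le_max_right _ _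
  simp only [max_le_iff] at hM2
  obtain ⟨m0, m1, m2, m3, m4⟩ := hM2
  set r := max 1 (max (S.R₀ + 1) (max r₁ r₂)) with hr
  have hr1 : 1 ≤ r := le_max_left _ _
  have hr2 : max (S.R₀ + 1) (max r₁ r₂) ≤ r := le_max_right _ _
  simp only [max_le_iff] at hr2
  obtain ⟨q0, q1, q2⟩ := hr2
  have hOmem : ∀ x, r ≤ ‖x‖ → x ∈ O := fun x hx => (hmemO x).mpr (by linarith)
  have hdiff : ∀ x : Euc n, r ≤ ‖x‖ → ∀ i j,
      |pd i (pd j S.ul) x - ((if i = j then 1 else 0) - x i / ‖x‖ * (x j / ‖x‖)) / ‖x‖|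
        ≤ M / ‖x‖ ^ 2 := fun x hx i j => by
    have hxO := hOmem x hx
    have hxp : 0 < ‖x‖ := by linarith
    have e0 : pd i (pd j fun y => S.ul y - ‖y‖) x
        = pd i (pd j S.ul) x - pd i (pd j fun y => ‖y‖) x :=
      (pd_congr hO (pd_sub hO hulO hnO j) i hxO).trans
        (pd_sub hO (hulO.pd hO j) (hnO.pd hO j) i hxO)
    rw [← pd_pd_norm (hO0 hxO), ← e0, ← iteratedFDeriv_two_single hO (hulO.sub hnO) hxO]
    have e1 := abs_iteratedFDeriv_single_le 2 (fun y => S.ul y - ‖y‖) x ![i, j]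
    have e2 : (fun k : Fin 2 => EuclideanSpace.single (![i, j] k) (1 : ℝ))
        = ![EuclideanSpace.single i 1, EuclideanSpace.single j 1] := by
      ext k
      fin_cases k <;> rfl
    rw [e2] at e1
    have e3 := h2 x (q2.trans hx)
    have e4 := norm_nonneg (iteratedFDeriv ℝ 3 S.ul x)
    refine e1.trans ((by linarith : _ ≤ C₂ / ‖x‖ ^ 2).trans ?_)
    gcongr
    exact (le_abs_self _).trans m2
  refine ⟨M + 2, r, ⟨by linarith, hr1, by linarith, fun x hx => (h0 x hx).trans ?_, ?_, ?_, ?_, ?_,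
    ?_, ?_⟩⟩
  · linarith [le_abs_self C₀]
  · intro x hx
    have hxO := hOmem x hx
    have e1 := h1 x (q1.trans hx)
    rw [fderiv_fun_sub (hulO.differentiableAt_of_isOpen hO hxO)
      (hnO.differentiableAt_of_isOpen hO hxO)] at e1
    have e2 : ‖fderiv ℝ (fun y : Euc n => ‖y‖) x‖ ≤ 1 := by
      have := norm_fderiv_le_of_lipschitz ℝ (lipschitzWith_one_norm (E := Euc n)) (x₀ := x)
      simpa using this
    have e3 : C₁ / ‖x‖ ≤ M := by
      have hx1 : 1 ≤ ‖x‖ := hr1.trans hx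
      rw [div_le_iff₀ (by linarith)]
      nlinarith [le_abs_self C₁]
    have e4 := norm_le_norm_sub_add (fderiv ℝ S.ul x) (fderiv ℝ (fun y : Euc n => ‖y‖) x)
    linarith
  · intro x hx i j
    refine (hdiff x hx i j).trans ?_
    gcongr
    linarith
  · intro x hx i j
    have hx1 : 1 ≤ ‖x‖ := hr1.trans hx
    have e1 := hdiff x hx i j
    have e2 : |((if i = j then (1 : ℝ) else 0) - x i / ‖x‖ * (x j / ‖x‖)) / ‖x‖| ≤ 2 / ‖x‖ := by
      rw [abs_div, abs_norm]
      gcongr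
      refine (abs_sub _ _).trans ?_
      have a1 : |if i = j then (1 : ℝ) else 0| ≤ 1 := by split_ifs <;> simp
      have a2 : |x i / ‖x‖ * (x j / ‖x‖)| ≤ 1 := by
        rw [abs_mul]
        exact mul_le_one₀ (abs_apply_div_norm_le x i) (abs_nonneg _) (abs_apply_div_norm_le x j)
      linarith
    have e3 : M / ‖x‖ ^ 2 ≤ M / ‖x‖ := by
      gcongr
      nlinarith
    have e4 := abs_sub_abs_le_abs_sub (pd i (pd j S.ul) x)
      (((if i = j then (1 : ℝ) else 0) - x i / ‖x‖ * (x j / ‖x‖)) / ‖x‖)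
    rw [add_div]
    linarith
  · intro x hx i j k
    have hxO := hOmem x hx
    rw [← iteratedFDeriv_three_single hO hulO hxO]
    have e1 := abs_iteratedFDeriv_single_le 3 S.ul x ![i, j, k]
    have e2 : (fun l : Fin 3 => EuclideanSpace.single (![i, j, k] l) (1 : ℝ))
        = ![EuclideanSpace.single i 1, EuclideanSpace.single j 1, EuclideanSpace.single k 1] := by
      ext l
      fin_cases l <;> rfl
    rw [e2] at e1
    have e3 := h2 x (q2.trans hx)
    have e4 := norm_nonneg (iteratedFDeriv ℝ 2 (fun y => S.ul y - ‖y‖) x)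
    refine e1.trans ((by linarith : _ ≤ C₂ / ‖x‖ ^ 2).trans ?_)
    gcongr
    linarith [le_abs_self C₂]
  · intro x hx z
    linarith [h3 x hx z, le_abs_self C₃]
  · intro x hx z
    have hmem : ((x, z) : Euc n × ℝ) ∈ (S.Kᶜ ×ˢ (univ : Set ℝ)) := ⟨hx, mem_univ _⟩
    have hnhds : (interior S.K)ᶜ ×ˢ (univ : Set ℝ) ∈ 𝓝 ((x, z) : Euc n × ℝ) :=
      mem_of_superset ((S.hKc.isClosed.isOpen_compl.prod isOpen_univ).mem_nhds hmem)
        (prod_mono (compl_K_subset_compl_interior S) Subset.rfl)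
    have e1 := h4 (x, z) ⟨compl_K_subset_compl_interior S hx, mem_univ _⟩
    rw [fderivWithin_of_mem_nhds hnhds] at e1
    refine ((le_add_of_nonneg_right (norm_nonneg _)).trans e1).trans ?_
    have := S.hfpos x (compl_K_subset_compl_interior S hx) z
    dsimp only
    gcongr
    linarith [le_abs_self C₄]

end FarField

section Gradient

variable {n : ℕ} {S : ExtSetting n} {C R₁ R : ℝ} {u : Euc n → ℝ} {x v : Euc n}

theorem abs_sum_mul_mul_le {κ : ℝ} (hv : ∀ i, |v i| ≤ 1) {m : Fin n → Fin n → ℝ}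
    (hm : ∀ i j, |m i j| ≤ κ) : |∑ i, ∑ j, v i * v j * m i j| ≤ n ^ 2 * κ := by
  calc |∑ i, ∑ j, v i * v j * m i j| ≤ ∑ i, ∑ j, |v i * v j * m i j| :=
        (Finset.abs_sum_le_sum_abs _ _).trans
          (Finset.sum_le_sum fun i _ => Finset.abs_sum_le_sum_abs _ _)
    _ ≤ ∑ _i : Fin n, ∑ _j : Fin n, κ := by
        refine Finset.sum_le_sum fun i _ => Finset.sum_le_sum fun j _ => ?_
        rw [abs_mul, abs_mul]
        exact (mul_le_mul (mul_le_one₀ (hv i) (abs_nonneg _) (hv j)) (hm i j) (abs_nonneg _)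
          zero_le_one).trans_eq (one_mul κ)
    _ = n ^ 2 * κ := by simp; ring

theorem IsSol.contDiffOn_sub (hu : IsSol S R u) :
    ContDiffOn ℝ (⊤ : ℕ∞) (fun y => u y - S.ul y) (solDom S R) :=
  hu.1.sub (S.hulsm.mono (solDom_subset_compl_interior S R))

theorem mem_ball_diff_K (h0 : S.R₀ ≤ ‖x‖) (hR : ‖x‖ < R) : x ∈ ball (0 : Euc n) R \ S.K :=
  ⟨mem_ball_zero_iff.mpr hR, notMem_K_of_le_norm S h0⟩

theorem mem_solDom (h0 : S.R₀ ≤ ‖x‖) (hR : ‖x‖ ≤ R) : x ∈ solDom S R :=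
  ⟨mem_closedBall_zero_iff.mpr hR, compl_K_subset_compl_interior S (notMem_K_of_le_norm S h0)⟩

theorem sqrt_le_div_four (hR : 16 ≤ R) : √R ≤ R / 4 := by
  have h4 : (4 : ℝ) ≤ √R := Real.le_sqrt_of_sq_le (by linarith)
  nlinarith [Real.mul_self_sqrt (by linarith : 0 ≤ R)]

namespace FarBound

theorem sub_le (hF : FarBound S C R₁) (hu : IsSol S R u) (h0 : S.R₀ ≤ ‖x‖) (hR : ‖x‖ ≤ R) :
    u x - S.ul x ≤ 2 * C := by
  have h1 := hu.le_norm_add S hF.abs_sub_le h0 hR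
  have h2 := (abs_le.mp (hF.abs_sub_le x (mem_solDom h0 hR).2)).1
  linarith

theorem fderivWithin_sub_apply_le (hF : FarBound S C R₁) (hu : IsSol S R u) (hR : 16 * R₁ ≤ R)
    (hx : 3 / 4 * R ≤ ‖x‖) (hxR : ‖x‖ ≤ R) {D : Euc n →L[ℝ] ℝ}
    (hD : HasFDerivWithinAt (fun y => u y - S.ul y) D (solDom S R) x) (hv : ‖v‖ = 1) {L : ℝ}
    (hL : 0 < L) (hLR : L ≤ √R) (hxL : ‖x + L • v‖ ≤ R)
    (hin : ∀ s ∈ Ioo 0 L, ‖x + s • v‖ < R) :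
    D v ≤ (u (x + L • v) - S.ul (x + L • v)) / L + n ^ 2 * C / √R := by
  have hR1 := hF.one_le_radius
  have hR0 := hF.R₀_lt
  have hC := hF.one_le
  have hRp : 0 < R := by linarith
  have hsq := sqrt_le_div_four (by linarith : 16 ≤ R)
  have hfar : ∀ s, 0 ≤ s → s ≤ L → R / 2 ≤ ‖x + s • v‖ := fun s h0 h1 => by
    have := norm_sub_le (x + s • v) (s • v)
    rw [add_sub_cancel_right, norm_smul, hv, Real.norm_of_nonneg h0] at this
    linarith
  have hO := isOpen_ball_diff_K S R
  have hmem : ∀ s ∈ Ioo 0 L, x + s • v ∈ ball (0 : Euc n) R \ S.K := fun s hs =>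
    mem_ball_diff_K (by linarith [hfar s hs.1.le hs.2.le]) (hin s hs)
  have hpos : ∀ s ∈ Ioo 0 L, 0 ≤ ∑ i, ∑ j, v i * v j *
      pd i (pd j fun y => u y - S.ul y) (x + s • v) + n ^ 2 * (2 * C / R) := fun s hs => by
    have h1 := hu.sum_pd_pd_nonneg S (hmem s hs) v
    have hsub : ∀ i j, pd i (pd j fun y => u y - S.ul y) (x + s • v)
        = pd i (pd j u) (x + s • v) - pd i (pd j S.ul) (x + s • v) := fun i j =>
      (pd_congr hO (pd_sub hO hu.contDiffOn_ball_diff_K (ul_contDiffOn_ball_diff_K S R) j) i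
        (hmem s hs)).trans (pd_sub hO (hu.contDiffOn_ball_diff_K.pd hO j)
          ((ul_contDiffOn_ball_diff_K S R).pd hO j) i (hmem s hs))
    have hs2 := hfar s hs.1.le hs.2.le
    have h2 := abs_sum_mul_mul_le (κ := 2 * C / R)
      (fun i => (PiLp.norm_apply_le v i).trans hv.le) (m := fun i j => pd i (pd j S.ul) (x + s • v))
      fun i j => (hF.abs_pd_pd_le _ (by linarith) i j).trans (by
        rw [div_le_div_iff₀ (by linarith) (by linarith)]
        nlinarith)
    simp only [hsub, mul_sub, Finset.sum_sub_distrib]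
    linarith [(abs_le.mp h2).2]
  have key := fderivWithin_apply_le_of_chord hO (ball_diff_K_subset_solDom S R)
    (hu.contDiffOn_sub.mono (ball_diff_K_subset_solDom S R)) hu.contDiffOn_sub.continuousOn hD hL
    (mem_solDom (by linarith) hxR) (mem_solDom (by linarith [hfar L hL.le le_rfl]) hxL) hmem hpos
  have hw : 0 ≤ u x - S.ul x :=
    sub_nonneg.mpr (hu.ul_le S x (mem_solDom (by linarith) hxR))
  refine key.trans (add_le_add (div_le_div_of_nonneg_right (by linarith) hL.le) ?_)
  calc n ^ 2 * (2 * C / R) * L / 2 ≤ n ^ 2 * (2 * C / R) * √R / 2 := by gcongr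
    _ = n ^ 2 * C / √R := by
      rw [div_eq_mul_inv _ (√R), ← Real.sqrt_div_self]
      ring

theorem fderivWithin_sub_apply_le_of_chord (hF : FarBound S C R₁) (hu : IsSol S R u)
    (hR : 16 * R₁ ≤ R) (hx : 3 / 4 * R ≤ ‖x‖) (hxR : ‖x‖ ≤ R) {D : Euc n →L[ℝ] ℝ}
    (hD : HasFDerivWithinAt (fun y => u y - S.ul y) D (solDom S R) x) (hv : ‖v‖ = 1) {L : ℝ}
    (hL : 0 < L) (hLR : L ≤ √R) (hxL : ‖x + L • v‖ ≤ R)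
    (hin : ∀ s ∈ Ioo 0 L, ‖x + s • v‖ < R) (hend : L = √R ∨ ‖x + L • v‖ = R) :
    D v ≤ (n ^ 2 + 2) * C / √R := by
  have hR1 := hF.one_le_radius
  have hR0 := hF.R₀_lt
  have hC := hF.one_le
  refine (hF.fderivWithin_sub_apply_le hu hR hx hxR hD hv hL hLR hxL hin).trans ?_
  rw [add_mul, add_div, add_comm]
  refine add_le_add le_rfl ?_
  rcases hend with rfl | h
  · gcongr
    have := norm_sub_le (x + √R • v) (√R • v)
    rw [add_sub_cancel_right, norm_smul, hv, Real.norm_of_nonneg hL.le] at this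
    have hsq := sqrt_le_div_four (by linarith : 16 ≤ R)
    exact hF.sub_le hu (by linarith) hxL
  · rw [hu.2.2.2 _ (Or.inl (by simp [h])), sub_self, zero_div]
    positivity

theorem norm_fderiv_sub_le (hF : FarBound S C R₁) (hu : IsSol S R u)
    (hR : 16 * R₁ ≤ R) (hx : 3 / 4 * R ≤ ‖x‖) (hxR : ‖x‖ < R) :
    ‖fderiv ℝ (fun y => u y - S.ul y) x‖ ≤ (n ^ 2 + 2) * C / √R := by
  have hR1 := hF.one_le_radius
  have hR0 := hF.R₀_lt
  have hC := hF.one_le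
  have hsp : 0 < √R := Real.sqrt_pos.mpr (by linarith)
  have hO := isOpen_ball_diff_K S R
  have hD : HasFDerivWithinAt (fun y => u y - S.ul y) (fderiv ℝ (fun y => u y - S.ul y) x)
      (solDom S R) x :=
    ((hu.contDiffOn_sub.mono (ball_diff_K_subset_solDom S R)).differentiableAt_of_isOpen hO
      (mem_ball_diff_K (by linarith) hxR)).hasFDerivAt.hasFDerivWithinAt
  have key : ∀ v : Euc n, ‖v‖ = 1 →
      fderiv ℝ (fun y => u y - S.ul y) x v ≤ (n ^ 2 + 2) * C / √R := fun v hv => by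
    obtain ⟨L, hL, hLR, hxL, hend⟩ : ∃ L, 0 < L ∧ L ≤ √R ∧ ‖x + L • v‖ ≤ R ∧
        (L = √R ∨ ‖x + L • v‖ = R) := by
      by_cases h : ‖x + √R • v‖ ≤ R
      · exact ⟨√R, hsp, le_rfl, h, Or.inl rfl⟩
      · have hc : ContinuousOn (fun s : ℝ => ‖x + s • v‖) (Icc 0 √R) := by fun_prop
        obtain ⟨L, hL, hLe⟩ := intermediate_value_Icc hsp.le hc
          ⟨by simpa using hxR.le, (not_le.mp h).le⟩
        refine ⟨L, lt_of_le_of_ne hL.1 ?_, hL.2, hLe.le, Or.inr hLe⟩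
        rintro rfl
        simp at hLe
        exact hxR.ne hLe
    refine hF.fderivWithin_sub_apply_le_of_chord hu hR hx hxR.le hD hv hL hLR hxL
      (fun s hs => ?_) hend
    have hs1 : s / L < 1 := (div_lt_one hL).mpr hs.2
    have e : x + s • v = (1 - s / L) • x + (s / L) • (x + L • v) := by
      rw [smul_add, smul_smul, div_mul_cancel₀ _ hL.ne', sub_smul, one_smul]
      abel
    have h0 : 0 < s / L := div_pos hs.1 hL
    calc ‖x + s • v‖ ≤ (1 - s / L) * ‖x‖ + s / L * ‖x + L • v‖ := by
          rw [e]
          refine (norm_add_le _ _).trans_eq ?_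
          rw [norm_smul, norm_smul, Real.norm_of_nonneg h0.le,
            Real.norm_of_nonneg (by linarith)]
      _ < R := by nlinarith
  refine ContinuousLinearMap.opNorm_le_of_unit_norm (by positivity) fun v hv => ?_
  rw [Real.norm_eq_abs, abs_le]
  have h1 := key (-v) (by rwa [norm_neg])
  rw [map_neg] at h1
  exact ⟨by linarith, key v hv⟩

/-- On the outer sphere `u - u̲` has vanishing tangential derivatives and a controlled normal
derivative. -/
theorem abs_fderivWithin_sub_apply_le (hF : FarBound S C R₁) (hu : IsSol S R u)
    (hR : 16 * R₁ ≤ R) (hxR : ‖x‖ = R) {D : Euc n →L[ℝ] ℝ}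
    (hD : HasFDerivWithinAt (fun y => u y - S.ul y) D (solDom S R) x) (v : Euc n) :
    |D v| ≤ |⟪x, v⟫| / R * ((n ^ 2 + 2) * C / √R) := by
  have hR1 := hF.one_le_radius
  have hR0 := hF.R₀_lt
  have hC := hF.one_le
  have hRp : 0 < R := by linarith
  have hsp : 0 < √R := Real.sqrt_pos.mpr hRp
  have hmin : IsLocalMinOn (fun y => u y - S.ul y) (solDom S R) x := by
    refine IsMinOn.localize fun y hy => ?_
    have h1 := hu.ul_le S y hy
    have h2 := hu.2.2.2 x (Or.inl (by simp [hxR]))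
    change u x - S.ul x ≤ u y - S.ul y
    linarith
  have hneg : ∀ y : Euc n, ⟪x, y⟫ < 0 → 0 ≤ D y := fun y hy => by
    refine hmin.hasFDerivWithinAt_nonneg hD (mem_posTangentConeAt_of_frequently_mem ?_)
    refine Eventually.frequently ?_
    have c1 : ContinuousAt (fun s : ℝ => ‖x + s • y‖) 0 := by fun_prop
    have c2 : ContinuousAt (fun s : ℝ => 2 * ⟪x, y⟫ + s * ‖y‖ ^ 2) 0 := by fun_prop
    have e1 : ∀ᶠ s : ℝ in 𝓝[>] 0, S.R₀ < ‖x + s • y‖ :=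
      nhdsWithin_le_nhds (c1.eventually (lt_mem_nhds (by simp [hxR]; linarith)))
    have e2 : ∀ᶠ s : ℝ in 𝓝[>] 0, 2 * ⟪x, y⟫ + s * ‖y‖ ^ 2 < 0 :=
      nhdsWithin_le_nhds (c2.eventually (gt_mem_nhds (by simp; linarith)))
    filter_upwards [e1, e2, self_mem_nhdsWithin] with s h1 h2 (h3 : 0 < s)
    refine mem_solDom h1.le ?_
    have h4 : ‖x + s • y‖ ^ 2 ≤ R ^ 2 := by
      rw [norm_add_sq_real, norm_smul, inner_smul_right, hxR, Real.norm_of_nonneg h3.le]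
      nlinarith
    exact (sq_le_sq₀ (norm_nonneg _) hRp.le).mp h4
  have hx0 : ⟪x, x⟫ = R ^ 2 := by rw [real_inner_self_eq_norm_sq, hxR]
  have hnonneg : ∀ y : Euc n, ⟪x, y⟫ = 0 → 0 ≤ D y := fun y hy => by
    have h1 : ∀ η : ℝ, 0 < η → 0 ≤ D y - η * D x := fun η hη => by
      have := hneg (y - η • x) (by
        rw [inner_sub_right, inner_smul_right, hy, hx0]
        nlinarith [sq_pos_of_pos hRp])
      simpa using this
    have h2 : Tendsto (fun η : ℝ => D y - η * D x) (𝓝[>] 0) (𝓝 (D y - 0 * D x)) :=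
      (Continuous.tendsto (by fun_prop) _).mono_left nhdsWithin_le_nhds
    rw [zero_mul, sub_zero] at h2
    exact ge_of_tendsto h2 (eventually_mem_nhdsWithin.mono fun η hη => h1 η hη)
  have htan : ∀ y : Euc n, ⟪x, y⟫ = 0 → D y = 0 := fun y hy => by
    have := hnonneg (-y) (by rw [inner_neg_right, hy, neg_zero])
    rw [map_neg] at this
    exact le_antisymm (by linarith) (hnonneg y hy)
  have hDx : |D x| ≤ R * ((n ^ 2 + 2) * C / √R) := by
    have h1 := hneg (-x) (by rw [inner_neg_right, hx0]; nlinarith [sq_pos_of_pos hRp])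
    have h2 := hF.fderivWithin_sub_apply_le_of_chord hu hR (by linarith) hxR.le hD
      (v := -(R⁻¹ • x)) (by
        rw [norm_neg, norm_smul, hxR, Real.norm_of_nonneg (by positivity)]
        field_simp) hsp le_rfl
    have hn : ∀ s : ℝ, 0 ≤ s → s ≤ √R → ‖x + s • -(R⁻¹ • x)‖ = R - s := fun s h0 hs => by
      have hsq := sqrt_le_div_four (by linarith : 16 ≤ R)
      have : x + s • -(R⁻¹ • x) = (1 - s * R⁻¹) • x := by
        rw [smul_neg, smul_smul, sub_smul, one_smul, sub_eq_add_neg]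
      rw [this, norm_smul, hxR, Real.norm_of_nonneg]
      · field_simp
      · rw [sub_nonneg, ← div_eq_mul_inv, div_le_one hRp]
        linarith
    have h3 := h2 (by rw [hn _ hsp.le le_rfl]; linarith)
      (fun s hs => by rw [hn s hs.1.le hs.2.le]; linarith [hs.1]) (Or.inl rfl)
    rw [map_neg] at h1 h3
    rw [map_smul, smul_eq_mul] at h3
    rw [abs_of_nonpos (by linarith)]
    have h4 : R⁻¹ * D x * R = D x := by field_simp
    nlinarith
  have hdec : D v = ⟪x, v⟫ / R ^ 2 * D x := by
    have := htan (v - (⟪x, v⟫ / R ^ 2) • x) (by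
      rw [inner_sub_right, inner_smul_right, hx0]
      field_simp
      ring)
    rw [map_sub, map_smul, smul_eq_mul] at this
    linarith
  rw [hdec, abs_mul, abs_div, abs_of_pos (by positivity : 0 < R ^ 2)]
  calc |⟪x, v⟫| / R ^ 2 * |D x| ≤ |⟪x, v⟫| / R ^ 2 * (R * ((n ^ 2 + 2) * C / √R)) := by
        gcongr
    _ = _ := by field_simp

end FarBound

end Gradient

section Boundary

variable {n : ℕ} {S : ExtSetting n} {C R₁ R : ℝ} {u : Euc n → ℝ} {x : Euc n}

theorem rpow_neg_half_eq (hR : 0 < R) : R ^ (-(1 : ℝ) / 2) = 1 / √R := by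
  rw [neg_div, Real.rpow_neg hR.le, Real.sqrt_eq_rpow, one_div (R ^ _)]

theorem rpow_neg_half_eq_mul (hR : 0 < R) :
    R ^ (-(1 : ℝ) / 2) = R ^ (-(5 : ℝ) / 4) * R ^ ((3 : ℝ) / 4) := by
  rw [← Real.rpow_add hR]
  norm_num

theorem rpow_three_quarters_sq (hR : 0 < R) : (R ^ ((3 : ℝ) / 4)) ^ 2 / R ^ 2 = 1 / √R := by
  rw [← rpow_neg_half_eq hR, ← Real.rpow_natCast, ← Real.rpow_mul hR.le, ← Real.rpow_natCast,
    ← Real.rpow_sub hR]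
  norm_num

theorem rpow_three_quarters_le (hR : 256 ≤ R) : R ^ ((3 : ℝ) / 4) ≤ R / 4 := by
  have hR0 : 0 < R := by linarith
  have h1 : (4 : ℝ) ≤ R ^ ((1 : ℝ) / 4) := by
    have h2 : (256 : ℝ) ^ ((1 : ℝ) / 4) ≤ R ^ ((1 : ℝ) / 4) := by gcongr
    have h3 : (256 : ℝ) ^ ((1 : ℝ) / 4) = 4 := by
      rw [show (256 : ℝ) = 4 ^ (4 : ℝ) by norm_num, ← Real.rpow_mul (by norm_num)]
      norm_num
    linarith
  have h4 : R ^ ((3 : ℝ) / 4) * R ^ ((1 : ℝ) / 4) = R := by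
    rw [← Real.rpow_add hR0]
    norm_num
  have h5 : 0 < R ^ ((3 : ℝ) / 4) := by positivity
  nlinarith

theorem Tlin_eq_fderivWithin (Ω : Set (Euc n)) (R : ℝ) (t last : Fin n) (w : Euc n → ℝ) :
    Tlin Ω R t last w x = fderivWithin ℝ w Ω x
      (EuclideanSpace.single t 1 - (x t / R) • EuclideanSpace.single last 1) := by
  simp [Tlin, pdW]

theorem sub_norm_le_norm_sub_single (hR : 0 ≤ R) (last : Fin n) :
    R - ‖x‖ ≤ ‖x - EuclideanSpace.single last R‖ := by
  have h := norm_sub_norm_le (EuclideanSpace.single last R : Euc n) x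
  rwa [PiLp.norm_single, Real.norm_of_nonneg hR, norm_sub_rev] at h

theorem vartheta_nonneg {ul : Euc n → ℝ} (hR : 0 < R) (hw : ul x ≤ u x) (hx : ‖x‖ ≤ R)
    (hd : R - ‖x‖ ≤ R ^ ((3 : ℝ) / 4)) : 0 ≤ vartheta R u ul x := by
  have h1 : 0 < R ^ (-(5 : ℝ) / 4) := by positivity
  have h2 : vartheta R u ul x = (u x - ul x)
      + R ^ (-(5 : ℝ) / 4) * ((R - ‖x‖) * (R ^ ((3 : ℝ) / 4) - (R - ‖x‖) / 2)) := by
    rw [vartheta, rpow_neg_half_eq_mul hR]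
    ring
  rw [h2]
  exact add_nonneg (sub_nonneg.mpr hw) (mul_nonneg h1.le
    (mul_nonneg (sub_nonneg.mpr hx) (by linarith)))

theorem FarBound.abs_Tlin_le (hF : FarBound S C R₁) (hu : IsSol S R u) (hR : 16 * R₁ ≤ R)
    (hx : 3 / 4 * R ≤ ‖x‖) (hxR : ‖x‖ ≤ R) {t last : Fin n}
    (h : ‖x‖ = R ∨ R ^ ((3 : ℝ) / 4) ≤ ‖x - EuclideanSpace.single last R‖) :
    |Tlin (solDom S R) R t last (fun z => u z - S.ul z) x|
      ≤ 2 * ((n ^ 2 + 2) * C) / R ^ 2 * ‖x - EuclideanSpace.single last R‖ ^ 2 := by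
  have hR1 := hF.one_le_radius
  have hR0 := hF.R₀_lt
  have hC := hF.one_le
  have hRp : 0 < R := by linarith
  have hsp : 0 < √R := Real.sqrt_pos.mpr hRp
  have hs1 : 1 ≤ √R := Real.one_le_sqrt.mpr (by linarith)
  set G : ℝ := (n ^ 2 + 2) * C with hG
  have hGp : 0 < G := by positivity
  set x₀ : Euc n := EuclideanSpace.single last R with hx₀
  have hΩ : x ∈ solDom S R := mem_solDom (by linarith) hxR
  rw [Tlin_eq_fderivWithin]
  set τ : Euc n := EuclideanSpace.single t 1 - (x t / R) • EuclideanSpace.single last 1 with hτ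
  have hxt : |x t| ≤ R := (PiLp.norm_apply_le x t).trans hxR
  by_cases hxe : ‖x‖ = R
  · have hD := ((hu.contDiffOn_sub x hΩ).differentiableWithinAt
      (by simp)).hasFDerivWithinAt
    refine (hF.abs_fderivWithin_sub_apply_le hu hR hxe hD τ).trans ?_
    have h1 : ⟪x, τ⟫ = x t * (R - x last) / R := by
      rw [hτ, inner_sub_right, inner_smul_right]
      simp only [EuclideanSpace.inner_single_right]
      simp
      field_simp
    have h2 : ‖x - x₀‖ ^ 2 = 2 * R * (R - x last) := by
      rw [norm_sub_sq_real, hxe, hx₀, PiLp.norm_single, Real.norm_of_nonneg hRp.le,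
        EuclideanSpace.inner_single_right]
      simp
      ring
    have h3 : 0 ≤ R - x last := by
      have := (le_abs_self _).trans (PiLp.norm_apply_le x last)
      linarith
    rw [h1, h2, abs_div, abs_mul, abs_of_nonneg h3, abs_of_pos hRp]
    calc |x t| * (R - x last) / R / R * (G / √R) ≤ R * (R - x last) / R / R * (G / 1) := by
          gcongr
      _ ≤ 4 * (R * (R - x last) / R / R * (G / 1)) := by
          have : 0 ≤ R * (R - x last) / R / R * (G / 1) := by positivity
          linarith
      _ = _ := by
          field_simp
          ring
  · have hlt : ‖x‖ < R := lt_of_le_of_ne hxR hxe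
    have hδ := h.resolve_left hxe
    have hnhds : solDom S R ∈ 𝓝 x := mem_of_superset
      ((isOpen_ball_diff_K S R).mem_nhds (mem_ball_diff_K (by linarith) hlt))
      (ball_diff_K_subset_solDom S R)
    rw [fderivWithin_of_mem_nhds hnhds]
    have hτn : ‖τ‖ ≤ 2 := by
      refine (norm_sub_le _ _).trans ?_
      rw [norm_smul, PiLp.norm_single, PiLp.norm_single, norm_one, mul_one,
        Real.norm_eq_abs, abs_div, abs_of_pos hRp]
      linarith [(div_le_one hRp).mpr hxt]
    have h1 := hF.norm_fderiv_sub_le hu hR hx hlt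
    calc |fderiv ℝ (fun z => u z - S.ul z) x τ| ≤ G / √R * 2 :=
          ((fderiv ℝ (fun z => u z - S.ul z) x).le_opNorm τ).trans
            (mul_le_mul h1 hτn (norm_nonneg _) (by positivity))
      _ = 2 * G * ((R ^ ((3 : ℝ) / 4)) ^ 2 / R ^ 2) := by
          rw [rpow_three_quarters_sq hRp]
          ring
      _ ≤ 2 * G * (‖x - x₀‖ ^ 2 / R ^ 2) := by gcongr
      _ = _ := by ring

theorem FarBound.boundary_nonneg (hF : FarBound S C R₁) (hu : IsSol S R u) (hR : 16 * R₁ ≤ R)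
    (hR' : 256 ≤ R) {t last : Fin n} {A s : ℝ}
    (hA : 2 * ((n ^ 2 + 2) * C) ≤ A) (hs : |s| ≤ 1)
    (hx : x ∈ frontier (ball (EuclideanSpace.single last R) (R ^ ((3 : ℝ) / 4)) ∩ ball 0 R)) :
    0 ≤ vartheta R u S.ul x + A / R ^ 2 * ‖x - EuclideanSpace.single last R‖ ^ 2
      + s * Tlin (solDom S R) R t last (fun z => u z - S.ul z) x := by
  have hR1 := hF.one_le_radius
  have hR0 := hF.R₀_lt
  have hRp : 0 < R := by linarith
  rw [(isOpen_ball.inter isOpen_ball).frontier_eq] at hx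
  have hcl := closure_inter_subset_inter_closure _ _ hx.1
  have h1 : ‖x - EuclideanSpace.single last R‖ ≤ R ^ ((3 : ℝ) / 4) := by
    simpa [dist_eq_norm] using closure_ball_subset_closedBall hcl.1
  have h2 : ‖x‖ ≤ R := by simpa using closure_ball_subset_closedBall hcl.2
  have hd := (sub_norm_le_norm_sub_single hRp.le last).trans h1
  have hx34 : 3 / 4 * R ≤ ‖x‖ := by linarith [rpow_three_quarters_le hR']
  have hϑ := vartheta_nonneg hRp (hu.ul_le S x (mem_solDom (by linarith) h2)) h2 hd
  have hT := hF.abs_Tlin_le hu hR hx34 h2 (t := t) (last := last) (by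
    by_contra! hcon
    exact hx.2 ⟨by simpa [dist_eq_norm] using hcon.2,
      by simpa using lt_of_le_of_ne h2 hcon.1⟩)
  have hsT : |s * Tlin (solDom S R) R t last (fun z => u z - S.ul z) x|
      ≤ A / R ^ 2 * ‖x - EuclideanSpace.single last R‖ ^ 2 := by
    rw [abs_mul]
    refine (mul_le_of_le_one_left (abs_nonneg _) hs).trans (hT.trans ?_)
    gcongr
  linarith [(abs_le.mp hsT).1]

end Boundary

section Linearized

variable {n : ℕ} {O : Set (Euc n)} {v w : Euc n → ℝ} {x : Euc n}

theorem pd_sum {ι : Type*} (s : Finset ι) {g : ι → Euc n → ℝ} (hO : IsOpen O)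
    (hg : ∀ a ∈ s, ContDiffOn ℝ (⊤ : ℕ∞) (g a) O) (k : Fin n) :
    EqOn (pd k fun y => ∑ a ∈ s, g a y) (fun y => ∑ a ∈ s, pd k (g a) y) O := fun y hy => by
  simp only [pd]
  rw [fderiv_fun_sum fun a ha => (hg a ha).differentiableAt_of_isOpen hO hy]
  simp

theorem pd_const_mul (hO : IsOpen O) (hw : ContDiffOn ℝ (⊤ : ℕ∞) w O) (c : ℝ) (k : Fin n) :
    EqOn (pd k fun y => c * w y) (fun y => c * pd k w y) O := fun y hy => by
  rw [pd_mul hO contDiffOn_const hw k hy]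
  simp [pd_const]

theorem pd_log (hw : DifferentiableAt ℝ w x) (hx : w x ≠ 0) (k : Fin n) :
    pd k (fun y => Real.log (w y)) x = pd k w x / w x := by
  simp only [pd]
  rw [fderiv.log hw hx]
  simp [div_eq_inv_mul]

/-- The first order coefficients `(n+2)/(1+|Du|²)·uⁱ` of the linearized operator. -/
def drift (u : Euc n → ℝ) (x : Euc n) (i : Fin n) : ℝ :=
  ((n : ℝ) + 2) / (1 + ‖fderiv ℝ u x‖ ^ 2) * pd i u x

theorem abs_drift_le (u : Euc n → ℝ) (x : Euc n) (i : Fin n) : |drift u x i| ≤ n + 2 := by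
  have h1 := abs_pd_le u x i
  have h2 := norm_nonneg (fderiv ℝ u x)
  rw [drift, abs_mul, abs_of_pos (by positivity), div_mul_eq_mul_div, div_le_iff₀ (by positivity)]
  gcongr
  nlinarith [sq_nonneg (‖fderiv ℝ u x‖ - 1)]

theorem abs_sum_drift_mul_le (u : Euc n → ℝ) (x : Euc n) {p : Fin n → ℝ} {c : ℝ}
    (hp : ∀ i, |p i| ≤ c) : |∑ i, drift u x i * p i| ≤ n * (n + 2) * c := by
  calc |∑ i, drift u x i * p i| ≤ ∑ i, |drift u x i * p i| := Finset.abs_sum_le_sum_abs _ _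
    _ ≤ ∑ _i : Fin n, ((n : ℝ) + 2) * c := by
        refine Finset.sum_le_sum fun i _ => ?_
        rw [abs_mul]
        exact mul_le_mul (abs_drift_le u x i) (hp i) (abs_nonneg _) (by positivity)
    _ = n * (n + 2) * c := by simp; ring

variable {S : ExtSetting n} {C R₁ R : ℝ} {u : Euc n → ℝ}

theorem IsSol.f_contDiffOn (hu : IsSol S R u) :
    ContDiffOn ℝ (⊤ : ℕ∞) (fun y => S.f y (u y)) (ball (0 : Euc n) R \ S.K) :=
  S.hfsm.comp (contDiffOn_id.prodMk hu.contDiffOn_ball_diff_K) fun _ hy =>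
    ⟨compl_K_subset_compl_interior S hy.2, mem_univ _⟩

/-- The differentiated equation `L u_k = ∂_k log f(·, u)`. -/
theorem IsSol.ellOp_pd (hu : IsSol S R u) (hx : x ∈ ball (0 : Euc n) R \ S.K) (k : Fin n) :
    ellOp (Hess u x)⁻¹ (drift u x) (pd k u) x = pd k (fun y => Real.log (S.f y (u y))) x := by
  set O := ball (0 : Euc n) R \ S.K with hOdef
  have hO : IsOpen O := isOpen_ball_diff_K S R
  have huO : ContDiffOn ℝ (⊤ : ℕ∞) u O := hu.contDiffOn_ball_diff_K
  have hfO := hu.f_contDiffOn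
  have hfpos : ∀ y ∈ O, 0 < S.f y (u y) := fun y hy =>
    S.hfpos y (compl_K_subset_compl_interior S hy.2) _
  set B := (Hess u x)⁻¹ with hB
  set N : Euc n → ℝ := fun y => 1 + ∑ i, pd i u y * pd i u y with hN
  have hNpos : ∀ y, 0 < N y := fun y =>
    add_pos_of_pos_of_nonneg one_pos (Finset.sum_nonneg fun i _ => mul_self_nonneg _)
  have hNeq : ∀ y, 1 + ‖fderiv ℝ u y‖ ^ 2 = N y := fun y => by
    simp only [hN, norm_sq_fderiv, ← sq]
  have hS1 : ContDiffOn ℝ (⊤ : ℕ∞) (fun y => ∑ i, pd i u y * pd i u y) O :=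
    ContDiffOn.sum fun i _ => (huO.pd hO i).mul (huO.pd hO i)
  have hNO : ContDiffOn ℝ (⊤ : ℕ∞) N O := contDiffOn_const.add hS1
  set H : Euc n → ℝ := fun y => ∑ i, ∑ j, B i j * pd i (pd j u) y with hH
  have hHij : ∀ i j, ContDiffOn ℝ (⊤ : ℕ∞) (fun y => B i j * pd i (pd j u) y) O := fun i j =>
    contDiffOn_const.mul ((huO.pd hO j).pd hO i)
  have hHO : ContDiffOn ℝ (⊤ : ℕ∞) H O :=
    ContDiffOn.sum fun i _ => ContDiffOn.sum fun j _ => hHij i j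
  set g : Euc n → ℝ := fun y => ((n : ℝ) + 2) / 2 * Real.log (N y) + Real.log (S.f y (u y))
    with hg
  have hlogN : ContDiffOn ℝ (⊤ : ℕ∞) (fun y => Real.log (N y)) O :=
    hNO.log fun y _ => (hNpos y).ne'
  have hlogf : ContDiffOn ℝ (⊤ : ℕ∞) (fun y => Real.log (S.f y (u y))) O :=
    hfO.log fun y hy => (hfpos y hy).ne'
  have hdet : ∀ y ∈ O, Real.log (Hess u y).det = g y := fun y hy => by
    have := log_gaussK (hu.2.1 y hy)
    rw [hu.2.2.1 y hy, hNeq] at this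
    simp only [hg]
    linarith
  have hHx : H x = n := by
    rw [← (hu.2.1 x hx).sum_inv_mul]
    simp only [hH, hB, Hess_apply hO huO hx]
  have hmin : IsLocalMin (fun y => H y - g y) x := by
    filter_upwards [hO.mem_nhds hx] with y hy
    have h1 := (hu.2.1 x hx).log_det_le (hu.2.1 y hy)
    rw [hdet y hy, hdet x hx] at h1
    simp only [Hess_apply hO huO hy] at h1
    rw [hHx]
    linarith
  have h0 : pd k (fun y => H y - g y) x = 0 := by simp [pd, hmin.fderiv_eq_zero]
  have hlogN' : ContDiffOn ℝ (⊤ : ℕ∞) (fun y => ((n : ℝ) + 2) / 2 * Real.log (N y)) O :=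
    contDiffOn_const.mul hlogN
  rw [pd_sub hO hHO (hlogN'.add hlogf) k hx] at h0
  dsimp only at h0
  rw [pd_add hO hlogN' hlogf k hx] at h0
  dsimp only at h0
  rw [pd_const_mul hO hlogN _ k hx] at h0
  dsimp only at h0
  rw [pd_log (hNO.differentiableAt_of_isOpen hO hx) (hNpos x).ne'] at h0
  have hpN : pd k N x = ∑ i, 2 * (pd i u x * pd i (pd k u) x) := by
    rw [pd_add hO contDiffOn_const hS1 k hx]
    dsimp only
    rw [pd_const, pd_sum Finset.univ hO (fun i _ => (huO.pd hO i).mul (huO.pd hO i)) k hx, zero_add]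
    refine Finset.sum_congr rfl fun i _ => ?_
    rw [pd_mul hO (huO.pd hO i) (huO.pd hO i) k hx]
    dsimp only
    rw [pd_pd_comm hO huO k i hx]
    ring
  have hpH : pd k H x = ∑ i, ∑ j, B i j * pd i (pd j (pd k u)) x := by
    rw [pd_sum Finset.univ hO (fun i _ => ContDiffOn.sum fun j _ => hHij i j) k hx]
    refine Finset.sum_congr rfl fun i _ => ?_
    rw [pd_sum Finset.univ hO (fun j _ => hHij i j) k hx]
    refine Finset.sum_congr rfl fun j _ => ?_
    rw [pd_const_mul hO ((huO.pd hO j).pd hO i) _ k hx]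
    dsimp only
    rw [pd_pd_comm hO (huO.pd hO j) k i hx,
      pd_congr hO (pd_pd_comm hO huO k j) i hx]
  have hdr : ((n : ℝ) + 2) / 2 * (pd k N x / N x) = ∑ i, drift u x i * pd i (pd k u) x := by
    rw [hpN, ← Finset.mul_sum]
    simp only [drift, hNeq, mul_assoc]
    rw [← Finset.mul_sum]
    ring
  rw [ellOp, ← hpH, ← hdr]
  linarith

theorem FarBound.abs_pd_log_f_le (hF : FarBound S C R₁) (hu : IsSol S R u)
    (hx : x ∈ ball (0 : Euc n) R \ S.K) (k : Fin n) :
    |pd k (fun y => Real.log (S.f y (u y))) x| ≤ C * (1 + |pd k u x|) := by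
  have hO := isOpen_ball_diff_K S R
  have hfpos : 0 < S.f x (u x) := S.hfpos x (compl_K_subset_compl_interior S hx.2) _
  rw [pd_log (hu.f_contDiffOn.differentiableAt_of_isOpen hO hx) hfpos.ne', abs_div,
    abs_of_pos hfpos, div_le_iff₀ hfpos]
  have hF' : DifferentiableAt ℝ (fun p : Euc n × ℝ => S.f p.1 p.2) (x, u x) := by
    have hmem : ((x, u x) : Euc n × ℝ) ∈ (S.Kᶜ ×ˢ (univ : Set ℝ)) := ⟨hx.2, mem_univ _⟩
    exact ((S.hfsm.mono (prod_mono (compl_K_subset_compl_interior S) Subset.rfl)).contDiffAt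
      ((S.hKc.isClosed.isOpen_compl.prod isOpen_univ).mem_nhds hmem)).differentiableAt (by simp)
  have h1 : HasFDerivAt (fun y : Euc n => (y, u y))
      ((ContinuousLinearMap.id ℝ (Euc n)).prod (fderiv ℝ u x)) x :=
    (hasFDerivAt_id x).prodMk
      (hu.contDiffOn_ball_diff_K.differentiableAt_of_isOpen hO hx).hasFDerivAt
  have h2 := HasFDerivAt.comp (g := fun p : Euc n × ℝ => S.f p.1 p.2) x hF'.hasFDerivAt h1
  have h5 : fderiv ℝ (fun y => S.f y (u y)) x = _ := h2.fderiv
  rw [pd, h5]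
  have h3 := (fderiv ℝ (fun p : Euc n × ℝ => S.f p.1 p.2) (x, u x)).le_opNorm
    (EuclideanSpace.single k 1, pd k u x)
  have h4 : ‖((EuclideanSpace.single k 1 : Euc n), pd k u x)‖ ≤ 1 + |pd k u x| := by
    rw [Prod.norm_def]
    refine max_le ?_ ?_
    · simp
    · simp
  calc |(fderiv ℝ (fun p : Euc n × ℝ => S.f p.1 p.2) (x, u x))
        (EuclideanSpace.single k 1, pd k u x)| ≤ C * S.f x (u x) * (1 + |pd k u x|) :=
        h3.trans (mul_le_mul (hF.norm_fderiv_f_le x hx.2 _) h4 (norm_nonneg _)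
          (mul_nonneg (zero_le_one.trans hF.one_le) hfpos.le))
    _ = _ := by ring

end Linearized

section Interior

variable {n : ℕ} {S : ExtSetting n} {C R₁ R : ℝ} {u : Euc n → ℝ} {x : Euc n}

/-- The part of the trace of `B` in the radial direction at `x`. -/
def radialPart (B : Matrix (Fin n) (Fin n) ℝ) (x : Euc n) : ℝ :=
  ∑ i, ∑ j, B i j * (x i / ‖x‖ * (x j / ‖x‖))

/-- The part of the trace of `B` in the directions tangential to the sphere through `x`. -/
def tangentialPart (B : Matrix (Fin n) (Fin n) ℝ) (x : Euc n) : ℝ :=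
  ∑ i, ∑ j, B i j * ((if i = j then 1 else 0) - x i / ‖x‖ * (x j / ‖x‖))

theorem tangentialPart_add_radialPart (B : Matrix (Fin n) (Fin n) ℝ) (x : Euc n) :
    tangentialPart B x + radialPart B x = B.trace := by
  simp only [tangentialPart, radialPart, ← Finset.sum_add_distrib, ← mul_add, sub_add_cancel]
  simp [Matrix.trace]

theorem sum_sq_div_norm (hx : x ≠ 0) : ∑ i, (x i / ‖x‖) ^ 2 = 1 := by
  simp only [div_pow]
  rw [← Finset.sum_div, ← EuclideanSpace.real_norm_sq_eq]
  exact div_self (pow_ne_zero 2 (norm_ne_zero_iff.mpr hx))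

theorem tangentialPart_nonneg {B : Matrix (Fin n) (Fin n) ℝ} (hB : B.PosSemidef) (hx : x ≠ 0) :
    0 ≤ tangentialPart B x := by
  refine hB.sum_mul_nonneg fun v => ?_
  have h1 : ∑ i, ∑ j, v i * v j * ((if i = j then 1 else 0) - x i / ‖x‖ * (x j / ‖x‖))
      = ∑ i, v i ^ 2 - (∑ i, v i * (x i / ‖x‖)) ^ 2 := by
    rw [sq (∑ i, v i * (x i / ‖x‖)), Finset.sum_mul_sum, ← Finset.sum_sub_distrib]
    refine Finset.sum_congr rfl fun i _ => ?_
    simp only [mul_sub, Finset.sum_sub_distrib]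
    congr 1
    · simp [sq]
    · exact Finset.sum_congr rfl fun j _ => by ring
  have h2 := Finset.sum_mul_sq_le_sq_mul_sq Finset.univ v fun i => x i / ‖x‖
  rw [sum_sq_div_norm hx, mul_one] at h2
  rw [h1]
  linarith

theorem inv_sq_le_two_div_sq (hR : 0 < R) (hx : 3 / 4 * R ≤ ‖x‖) :
    1 / ‖x‖ ^ 2 ≤ 2 / R ^ 2 := by
  have h1 : 0 < ‖x‖ := by linarith
  rw [div_le_div_iff₀ (by positivity) (by positivity)]
  nlinarith

theorem abs_apply_le_norm (x : Euc n) (i : Fin n) : |x i| ≤ ‖x‖ := by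
  simpa using PiLp.norm_apply_le x i

theorem IsSol.inv_Hess_posSemidef (hu : IsSol S R u) (hx : x ∈ ball (0 : Euc n) R \ S.K) :
    ((Hess u x)⁻¹).PosSemidef :=
  (hu.2.1 x hx).inv.posSemidef

theorem IsSol.inv_Hess_symm (hu : IsSol S R u) (hx : x ∈ ball (0 : Euc n) R \ S.K) (i j : Fin n) :
    (Hess u x)⁻¹ i j = (Hess u x)⁻¹ j i := by
  simpa using ((hu.2.1 x hx).inv.isHermitian.apply i j).symm

namespace FarBound

/-- The gradient of `u` is bounded close to the outer boundary. -/
theorem abs_pd_sub_le_one (hF : FarBound S C R₁) (hu : IsSol S R u) (hR : 16 * R₁ ≤ R)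
    (hCR : (n ^ 2 + 2) * C / √R ≤ 1) (hx : 3 / 4 * R ≤ ‖x‖) (hxR : ‖x‖ < R) (i : Fin n) :
    |pd i (fun y => u y - S.ul y) x| ≤ 1 :=
  (abs_pd_le _ x i).trans ((hF.norm_fderiv_sub_le hu hR hx hxR).trans hCR)

theorem R₀_le_norm (hF : FarBound S C R₁) (hR : 16 * R₁ ≤ R) (hx : 3 / 4 * R ≤ ‖x‖) :
    S.R₀ ≤ ‖x‖ := by
  linarith [hF.R₀_lt, hF.one_le_radius]

theorem norm_fderiv_sol_le (hF : FarBound S C R₁) (hu : IsSol S R u) (hR : 16 * R₁ ≤ R)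
    (hCR : (n ^ 2 + 2) * C / √R ≤ 1) (hx : 3 / 4 * R ≤ ‖x‖) (hxR : ‖x‖ < R) :
    ‖fderiv ℝ u x‖ ≤ C + 1 := by
  have hxO := mem_ball_diff_K (hF.R₀_le_norm hR hx) hxR
  have hO := isOpen_ball_diff_K S R
  have h1 := (hF.norm_fderiv_sub_le hu hR hx hxR).trans hCR
  rw [fderiv_fun_sub (hu.contDiffOn_ball_diff_K.differentiableAt_of_isOpen hO hxO)
    ((ul_contDiffOn_ball_diff_K S R).differentiableAt_of_isOpen hO hxO)] at h1
  have h2 := hF.norm_fderiv_le x (by linarith [hF.one_le_radius])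
  calc ‖fderiv ℝ u x‖ = ‖fderiv ℝ S.ul x + (fderiv ℝ u x - fderiv ℝ S.ul x)‖ := by
        rw [add_sub_cancel]
    _ ≤ C + 1 := (norm_add_le _ _).trans (add_le_add h2 h1)

theorem abs_ellOp_pd_sub_le (hF : FarBound S C R₁) (hu : IsSol S R u) (hR : 16 * R₁ ≤ R)
    (hCR : (n ^ 2 + 2) * C / √R ≤ 1) (hx : 3 / 4 * R ≤ ‖x‖) (hxR : ‖x‖ < R) (k : Fin n) :
    |ellOp (Hess u x)⁻¹ (drift u x) (pd k fun y => u y - S.ul y) x|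
      ≤ C * (C + 2) + n * (n + 2) * C + 2 * n ^ 2 * C * ((Hess u x)⁻¹).trace / R ^ 2 := by
  have hC := hF.one_le
  have hR1 := hF.one_le_radius
  have hxO := mem_ball_diff_K (hF.R₀_le_norm hR hx) hxR
  have hO := isOpen_ball_diff_K S R
  have huO := hu.contDiffOn_ball_diff_K
  have hulO := ul_contDiffOn_ball_diff_K S R
  have hB := hu.inv_Hess_posSemidef hxO
  have hxR1 : R₁ ≤ ‖x‖ := by linarith
  have hx1 : 1 ≤ ‖x‖ := by linarith
  have hT : 0 ≤ ((Hess u x)⁻¹).trace := hB.trace_nonneg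
  rw [ellOp_congr _ _ hO (pd_sub hO huO hulO k) hxO,
    ellOp_sub _ _ hO (huO.pd hO k) (hulO.pd hO k) hxO, hu.ellOp_pd hxO k]
  have h1 := hF.abs_pd_log_f_le hu hxO k
  have h2 : |pd k u x| ≤ C + 1 :=
    (abs_pd_le u x k).trans (hF.norm_fderiv_sol_le hu hR hCR hx hxR)
  have h3 : |∑ i, ∑ j, (Hess u x)⁻¹ i j * pd i (pd j (pd k S.ul)) x|
      ≤ n ^ 2 * (C / ‖x‖ ^ 2) * ((Hess u x)⁻¹).trace :=
    hB.abs_sum_mul_le fun i j => hF.abs_pd_pd_pd_le x hxR1 i j k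
  have h4 : |∑ i, drift u x i * pd i (pd k S.ul) x| ≤ n * (n + 2) * (C / ‖x‖) :=
    abs_sum_drift_mul_le u x fun i => hF.abs_pd_pd_le x hxR1 i k
  have h5 : C / ‖x‖ ≤ C := div_le_self (by linarith) hx1
  have h6 : C / ‖x‖ ^ 2 ≤ C * (2 / R ^ 2) := by
    have := mul_le_mul_of_nonneg_left (inv_sq_le_two_div_sq (by linarith : 0 < R) hx)
      (by linarith : 0 ≤ C)
    rwa [mul_one_div] at this
  have h7 : n ^ 2 * (C / ‖x‖ ^ 2) * ((Hess u x)⁻¹).trace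
      ≤ n ^ 2 * (C * (2 / R ^ 2)) * ((Hess u x)⁻¹).trace := by gcongr
  have h8 : n * (n + 2) * (C / ‖x‖) ≤ n * (n + 2) * C := by gcongr
  have h9 : C * (1 + |pd k u x|) ≤ C * (C + 2) :=
    mul_le_mul_of_nonneg_left (by linarith) (by linarith)
  have h10 : (n : ℝ) ^ 2 * (C * (2 / R ^ 2)) * ((Hess u x)⁻¹).trace
      = 2 * n ^ 2 * C * ((Hess u x)⁻¹).trace / R ^ 2 := by ring
  rw [ellOp]
  rw [abs_le] at h1 h3 h4 ⊢
  constructor <;> linarith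

theorem abs_ellOp_coord_mul_pd_sub_le (hF : FarBound S C R₁) (hu : IsSol S R u)
    (hR : 16 * R₁ ≤ R) (hCR : (n ^ 2 + 2) * C / √R ≤ 1) (hx : 3 / 4 * R ≤ ‖x‖) (hxR : ‖x‖ < R)
    (t k : Fin n) :
    |ellOp (Hess u x)⁻¹ (drift u x) (fun y => y t * pd k (fun y => u y - S.ul y) y) x|
      ≤ R * (C * (C + 2) + n * (n + 2) * C + 2 * n ^ 2 * C * ((Hess u x)⁻¹).trace / R ^ 2)
        + (n + 4) + 4 * n * C * ((Hess u x)⁻¹).trace / R := by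
  have hC := hF.one_le
  have hR1 := hF.one_le_radius
  have hxO := mem_ball_diff_K (hF.R₀_le_norm hR hx) hxR
  have hO := isOpen_ball_diff_K S R
  have huO := hu.contDiffOn_ball_diff_K
  have hulO := ul_contDiffOn_ball_diff_K S R
  have hB := hu.inv_Hess_posSemidef hxO
  have hxR1 : R₁ ≤ ‖x‖ := by linarith
  have hR0 : 0 < R := by linarith
  have hT : 0 ≤ ((Hess u x)⁻¹).trace := hB.trace_nonneg
  have hco : ContDiffOn ℝ (⊤ : ℕ∞) (fun y : Euc n => y t) (ball (0 : Euc n) R \ S.K) :=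
    (EuclideanSpace.proj t : Euc n →L[ℝ] ℝ).contDiff.contDiffOn
  rw [ellOp_mul _ _ hO hco ((huO.sub hulO).pd hO k) (hu.inv_Hess_symm hxO) hxO]
  have h1 := hF.abs_ellOp_pd_sub_le hu hR hCR hx hxR k
  have h2 := hF.abs_pd_sub_le_one hu hR hCR hx hxR k
  have h3 : ellOp (Hess u x)⁻¹ (drift u x) (fun y : Euc n => y t) x = - drift u x t := by
    simp [ellOp, pd_coord, pd_const]
  have h4 : ∑ i, ∑ j, (Hess u x)⁻¹ i j * (pd i (fun y : Euc n => y t) x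
      * pd j (pd k fun y => u y - S.ul y) x)
      = (if t = k then 1 else 0) - ∑ j, (Hess u x)⁻¹ t j * pd j (pd k S.ul) x := by
    have h5 : ∀ j, pd j (pd k fun y => u y - S.ul y) x = Hess u x j k - pd j (pd k S.ul) x :=
      fun j => by
        rw [pd_congr hO (pd_sub hO huO hulO k) j hxO,
          pd_sub hO (huO.pd hO k) (hulO.pd hO k) j hxO, Hess_apply hO huO hxO]
    have h6 : ∑ j, (Hess u x)⁻¹ t j * Hess u x j k = if t = k then 1 else 0 := by
      rw [← Matrix.mul_apply, Matrix.nonsing_inv_mul _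
        (isUnit_iff_ne_zero.mpr (hu.2.1 x hxO).det_pos.ne'), Matrix.one_apply]
    simp only [h5, pd_coord, ite_mul, one_mul, zero_mul, mul_ite, mul_zero]
    rw [← h6, ← Finset.sum_sub_distrib, Finset.sum_comm]
    simp [mul_sub]
  have h7 : |∑ j, (Hess u x)⁻¹ t j * pd j (pd k S.ul) x|
      ≤ 2 * n * C * ((Hess u x)⁻¹).trace / R := by
    calc |∑ j, (Hess u x)⁻¹ t j * pd j (pd k S.ul) x|
        ≤ ∑ j, |(Hess u x)⁻¹ t j * pd j (pd k S.ul) x| := Finset.abs_sum_le_sum_abs _ _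
      _ ≤ ∑ _j : Fin n, ((Hess u x)⁻¹).trace * (2 * C / R) := by
          refine Finset.sum_le_sum fun j _ => ?_
          rw [abs_mul]
          refine mul_le_mul (hB.abs_apply_le_trace t j)
            ((hF.abs_pd_pd_le x hxR1 j k).trans ?_) (abs_nonneg _) hT
          rw [div_le_div_iff₀ (by linarith) hR0]
          nlinarith
      _ = _ := by simp; ring
  rw [h3, h4]
  have h8 : |x t * ellOp (Hess u x)⁻¹ (drift u x) (pd k fun y => u y - S.ul y) x|
      ≤ R * (C * (C + 2) + n * (n + 2) * C + 2 * n ^ 2 * C * ((Hess u x)⁻¹).trace / R ^ 2) := by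
    rw [abs_mul]
    exact mul_le_mul ((abs_apply_le_norm x t).trans hxR.le) h1 (abs_nonneg _) hR0.le
  have h9 : |pd k (fun y => u y - S.ul y) x * -drift u x t| ≤ n + 2 := by
    rw [abs_mul, abs_neg]
    calc _ ≤ 1 * ((n : ℝ) + 2) :=
          mul_le_mul h2 (abs_drift_le u x t) (abs_nonneg _) zero_le_one
      _ = _ := one_mul _
  have h10 : |(if t = k then (1 : ℝ) else 0)| ≤ 1 := by split_ifs <;> simp
  have h11 : 4 * n * C * ((Hess u x)⁻¹).trace / R
      = 2 * (2 * n * C * ((Hess u x)⁻¹).trace / R) := by ring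
  rw [h11]
  rw [abs_le] at h7 h8 h9 h10 ⊢
  constructor <;> linarith

end FarBound

end Interior

section BarrierOperator

variable {n : ℕ} {S : ExtSetting n} {C R₁ R : ℝ} {u : Euc n → ℝ} {x : Euc n}

theorem tangentialPart_div_eq (B : Matrix (Fin n) (Fin n) ℝ) (hx : x ≠ 0) :
    tangentialPart B x / ‖x‖ = ∑ i, ∑ j, B i j * pd i (pd j fun y : Euc n => ‖y‖) x := by
  simp only [tangentialPart, pd_pd_norm hx, Finset.sum_div, mul_div_assoc]

theorem ellOp_norm (B : Matrix (Fin n) (Fin n) ℝ) (q : Fin n → ℝ) (hx : x ≠ 0) :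
    ellOp B q (fun y : Euc n => ‖y‖) x = tangentialPart B x / ‖x‖ - ∑ i, q i * (x i / ‖x‖) := by
  simp only [ellOp, tangentialPart_div_eq B hx, pd_norm hx]

theorem ellOp_normSq (B : Matrix (Fin n) (Fin n) ℝ) (q : Fin n → ℝ) (x₀ : Euc n) :
    ellOp B q (fun y : Euc n => ‖y - x₀‖ ^ 2) x
      = 2 * B.trace - ∑ i, q i * (2 * (x i - x₀ i)) := by
  have hco : ∀ j : Fin n, ContDiffOn ℝ (⊤ : ℕ∞) (fun y : Euc n => y j) univ := fun j =>
    (EuclideanSpace.proj j : Euc n →L[ℝ] ℝ).contDiff.contDiffOn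
  have h : ∀ i j, pd i (fun y : Euc n => 2 * (y j - x₀ j)) x = if i = j then 2 else 0 := by
    intro i j
    rw [pd_const_mul isOpen_univ ((hco j).sub contDiffOn_const) 2 i (mem_univ x)]
    dsimp only
    rw [pd_sub isOpen_univ (hco j) contDiffOn_const i (mem_univ x)]
    dsimp only
    rw [pd_coord, pd_const]
    simp
  simp only [ellOp, pd_normSq, h]
  simp [Matrix.trace, Finset.mul_sum, mul_comm]

theorem ellOp_distance_le {B : Matrix (Fin n) (Fin n) ℝ} (hB : B.PosSemidef)
    (hBs : ∀ i j, B i j = B j i) (hx : x ≠ 0) {a b : ℝ}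
    (h0 : 0 ≤ a - b * (R - ‖x‖)) (h1 : a - b * (R - ‖x‖) ≤ 1) :
    ellOp B (drift u x) (fun y : Euc n => a * (R - ‖y‖) - 1 / 2 * b * (R - ‖y‖) ^ 2) x
      ≤ n * (n + 2) - b * radialPart B x := by
  have hO : IsOpen ({0}ᶜ : Set (Euc n)) := isOpen_compl_singleton
  have hd : ContDiffOn ℝ (⊤ : ℕ∞) (fun y : Euc n => R - ‖y‖) {0}ᶜ :=
    contDiffOn_const.sub contDiffOn_norm
  have hpd : ∀ i, pd i (fun y : Euc n => R - ‖y‖) x = - (x i / ‖x‖) := fun i => by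
    rw [pd_sub hO contDiffOn_const contDiffOn_norm i hx]
    dsimp only
    rw [pd_const, pd_norm hx]
    simp
  have hsq : (fun y : Euc n => (R - ‖y‖) ^ 2) = fun y => (R - ‖y‖) * (R - ‖y‖) := by
    ext y
    ring
  have hrad : ∑ i, ∑ j, B i j * (-(x i / ‖x‖) * -(x j / ‖x‖)) = radialPart B x := by
    simp only [neg_mul_neg, radialPart]
  rw [ellOp_sub _ _ hO (contDiffOn_const.mul hd) (contDiffOn_const.mul (hd.pow 2)) hx,
    ellOp_const_mul _ _ hO hd _ hx, ellOp_const_mul _ _ hO (hd.pow 2) _ hx, hsq,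
    ellOp_mul _ _ hO hd hd hBs hx]
  simp only [hpd, hrad]
  rw [ellOp_sub _ _ hO contDiffOn_const contDiffOn_norm hx, ellOp_const, ellOp_norm _ _ hx]
  have h2 : 0 ≤ tangentialPart B x / ‖x‖ :=
    div_nonneg (tangentialPart_nonneg hB hx) (norm_nonneg x)
  have h3 : |∑ i, drift u x i * (x i / ‖x‖)| ≤ n * (n + 2) * 1 :=
    abs_sum_drift_mul_le u x (abs_apply_div_norm_le x)
  have h4 : (0 : ℝ) ≤ n * (n + 2) := by positivity
  have h5 := (abs_le.mp h3).2
  set Y := ∑ i, drift u x i * (x i / ‖x‖)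
  set Z := tangentialPart B x / ‖x‖
  have h6 : (a - b * (R - ‖x‖)) * (Y - Z) ≤ n * (n + 2) := by
    calc (a - b * (R - ‖x‖)) * (Y - Z) ≤ (a - b * (R - ‖x‖)) * (n * (n + 2)) :=
          mul_le_mul_of_nonneg_left (by linarith) h0
      _ ≤ 1 * (n * (n + 2)) := mul_le_mul_of_nonneg_right h1 h4
      _ = _ := one_mul _
  linarith

namespace FarBound

theorem ellOp_sub_le (hF : FarBound S C R₁) (hu : IsSol S R u) (hR : 16 * R₁ ≤ R)
    (hCR : (n ^ 2 + 2) * C / √R ≤ 1) (hx : 3 / 4 * R ≤ ‖x‖) (hxR : ‖x‖ < R) :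
    ellOp (Hess u x)⁻¹ (drift u x) (fun y => u y - S.ul y) x
      ≤ n + n * (n + 2) - tangentialPart (Hess u x)⁻¹ x / R
        + 2 * n ^ 2 * C * ((Hess u x)⁻¹).trace / R ^ 2 := by
  have hC := hF.one_le
  have hR1 := hF.one_le_radius
  have hxO := mem_ball_diff_K (hF.R₀_le_norm hR hx) hxR
  have hO := isOpen_ball_diff_K S R
  have huO := hu.contDiffOn_ball_diff_K
  have hulO := ul_contDiffOn_ball_diff_K S R
  have hB := hu.inv_Hess_posSemidef hxO
  have hxR1 : R₁ ≤ ‖x‖ := by linarith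
  have hR0 : 0 < R := by linarith
  have hr : 0 < ‖x‖ := by linarith
  have hx0 : x ≠ 0 := norm_pos_iff.mp hr
  have hT : 0 ≤ ((Hess u x)⁻¹).trace := hB.trace_nonneg
  have h1 : ∀ i j, pd i (pd j fun y => u y - S.ul y) x
      = Hess u x i j - pd i (pd j fun y : Euc n => ‖y‖) x
        - (pd i (pd j S.ul) x - pd i (pd j fun y : Euc n => ‖y‖) x) := fun i j => by
    rw [pd_congr hO (pd_sub hO huO hulO j) i hxO,
      pd_sub hO (huO.pd hO j) (hulO.pd hO j) i hxO, Hess_apply hO huO hxO]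
    ring
  have h2 : |∑ i, ∑ j, (Hess u x)⁻¹ i j
      * (pd i (pd j S.ul) x - pd i (pd j fun y : Euc n => ‖y‖) x)|
      ≤ n ^ 2 * (C / ‖x‖ ^ 2) * ((Hess u x)⁻¹).trace := by
    refine hB.abs_sum_mul_le fun i j => ?_
    rw [pd_pd_norm hx0]
    exact hF.abs_pd_pd_sub_le x hxR1 i j
  have h3 : C / ‖x‖ ^ 2 ≤ C * (2 / R ^ 2) := by
    have := mul_le_mul_of_nonneg_left (inv_sq_le_two_div_sq hR0 hx) (by linarith : 0 ≤ C)
    rwa [mul_one_div] at this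
  have h4 : n ^ 2 * (C / ‖x‖ ^ 2) * ((Hess u x)⁻¹).trace
      ≤ n ^ 2 * (C * (2 / R ^ 2)) * ((Hess u x)⁻¹).trace := by gcongr
  have h5 : (n : ℝ) ^ 2 * (C * (2 / R ^ 2)) * ((Hess u x)⁻¹).trace
      = 2 * n ^ 2 * C * ((Hess u x)⁻¹).trace / R ^ 2 := by ring
  have h6 : |∑ i, drift u x i * pd i (fun y => u y - S.ul y) x| ≤ n * (n + 2) * 1 :=
    abs_sum_drift_mul_le u x fun i => hF.abs_pd_sub_le_one hu hR hCR hx hxR i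
  have h7 : tangentialPart (Hess u x)⁻¹ x / R ≤ tangentialPart (Hess u x)⁻¹ x / ‖x‖ :=
    div_le_div_of_nonneg_left (tangentialPart_nonneg hB hx0) hr hxR.le
  rw [ellOp]
  simp only [h1, mul_sub (_ : ℝ) (_ - _), mul_sub (_ : ℝ) (Hess u x _ _), Finset.sum_sub_distrib]
  rw [(hu.2.1 x hxO).sum_inv_mul, ← tangentialPart_div_eq _ hx0]
  have h8 := (abs_le.mp h2).1
  have h9 := (abs_le.mp h6).1
  simp only [mul_sub, Finset.sum_sub_distrib] at h8 ⊢
  linarith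

theorem abs_ellOp_tangential_le (hF : FarBound S C R₁) (hu : IsSol S R u) (hR : 16 * R₁ ≤ R)
    (hCR : (n ^ 2 + 2) * C / √R ≤ 1) (hx : 3 / 4 * R ≤ ‖x‖) (hxR : ‖x‖ < R) (t k : Fin n) :
    |ellOp (Hess u x)⁻¹ (drift u x) (fun y => pd t (fun z => u z - S.ul z) y
        - 1 / R * (y t * pd k (fun z => u z - S.ul z) y)) x|
      ≤ 2 * (C * (C + 2) + n * (n + 2) * C) + (n + 4)
        + (4 * n ^ 2 * C + 4 * n * C) * ((Hess u x)⁻¹).trace / R ^ 2 := by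
  have hR1 := hF.one_le_radius
  have hxO := mem_ball_diff_K (hF.R₀_le_norm hR hx) hxR
  have hO := isOpen_ball_diff_K S R
  have hR0 : 0 < R := by linarith
  have hwO : ContDiffOn ℝ (⊤ : ℕ∞) (fun z => u z - S.ul z) (ball (0 : Euc n) R \ S.K) :=
    hu.contDiffOn_ball_diff_K.sub (ul_contDiffOn_ball_diff_K S R)
  have hco : ContDiffOn ℝ (⊤ : ℕ∞) (fun y : Euc n => y t) (ball (0 : Euc n) R \ S.K) :=
    (EuclideanSpace.proj t : Euc n →L[ℝ] ℝ).contDiff.contDiffOn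
  rw [ellOp_sub _ _ hO (hwO.pd hO t) (contDiffOn_const.mul (hco.mul (hwO.pd hO k))) hxO,
    ellOp_const_mul _ _ hO (hco.mul (hwO.pd hO k)) _ hxO]
  have h1 := hF.abs_ellOp_pd_sub_le hu hR hCR hx hxR t
  have h2 := hF.abs_ellOp_coord_mul_pd_sub_le hu hR hCR hx hxR t k
  have h3 := mul_le_mul_of_nonneg_left h2 (by positivity : 0 ≤ 1 / R)
  rw [← abs_of_pos (by positivity : 0 < 1 / R), ← abs_mul, abs_of_pos (by positivity : 0 < 1 / R)]
    at h3
  set T := ((Hess u x)⁻¹).trace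
  have h4 : 1 / R * (R * (C * (C + 2) + n * (n + 2) * C + 2 * n ^ 2 * C * T / R ^ 2)
      + (n + 4) + 4 * n * C * T / R) = (C * (C + 2) + n * (n + 2) * C + 2 * n ^ 2 * C * T / R ^ 2)
      + (n + 4) / R + 4 * n * C * T / R ^ 2 := by
    field_simp
  have h5 : ((n : ℝ) + 4) / R ≤ n + 4 := div_le_self (by positivity) (by linarith)
  have h6 : (4 * n ^ 2 * C + 4 * n * C) * T / R ^ 2
      = 2 * (2 * n ^ 2 * C * T / R ^ 2) + 4 * n * C * T / R ^ 2 := by ring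
  rw [h4] at h3
  refine (abs_sub _ _).trans ?_
  linarith

/-- The lower bound for the elliptic term coming from the equation and the arithmetic–geometric
mean inequality. -/
theorem le_tangentialPart_add_radialPart (hF : FarBound S C R₁) (hu : IsSol S R u)
    (hR : 16 * R₁ ≤ R) (hCR : (n ^ 2 + 2) * C / √R ≤ 1) (hx : 3 / 4 * R ≤ ‖x‖)
    (hxR : ‖x‖ < R) :
    3 / 4 * Real.log R - (Real.log C + (n + 1) * Real.log 2
        + (n + 2) / 2 * Real.log (1 + (C + 1) ^ 2))
      ≤ tangentialPart (Hess u x)⁻¹ x / R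
        + R ^ (-(5 : ℝ) / 4) * radialPart (Hess u x)⁻¹ x := by
  have hC := hF.one_le
  have hR1 := hF.one_le_radius
  have hxO := mem_ball_diff_K (hF.R₀_le_norm hR hx) hxR
  have hR0 : 0 < R := by linarith
  have hr : 0 < ‖x‖ := by linarith
  have hx0 : x ≠ 0 := norm_pos_iff.mp hr
  have hn : 1 ≤ n := one_le_two.trans S.hn
  have hpos := hu.2.1 x hxO
  obtain ⟨hN, hNdet⟩ := posDef_and_det_rankOne hn (sum_sq_div_norm hx0)
    (by positivity : 0 < 1 / R) (by positivity : 0 < R ^ (-(5 : ℝ) / 4))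
  have h1 := hpos.log_det_le hN
  have h2 : ∑ i, ∑ j, (Hess u x)⁻¹ i j * (Matrix.of fun i j => 1 / R *
      ((if i = j then 1 else 0) - x i / ‖x‖ * (x j / ‖x‖))
      + R ^ (-(5 : ℝ) / 4) * (x i / ‖x‖ * (x j / ‖x‖))) i j
      = tangentialPart (Hess u x)⁻¹ x / R
        + R ^ (-(5 : ℝ) / 4) * radialPart (Hess u x)⁻¹ x := by
    simp only [Matrix.of_apply, tangentialPart, radialPart, Finset.sum_div, Finset.mul_sum,
      ← Finset.sum_add_distrib]
    exact Finset.sum_congr rfl fun i _ => Finset.sum_congr rfl fun j _ => by ring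
  rw [h2, hNdet, Real.log_mul (by positivity) (by positivity), Real.log_pow,
    Real.log_rpow hR0, one_div, Real.log_inv, Nat.cast_sub hn, Nat.cast_one] at h1
  have h3 := log_gaussK hpos
  have hxc := compl_K_subset_compl_interior S hxO.2
  have hfpos := S.hfpos x hxc (u x)
  rw [hu.2.2.1 x hxO] at h3
  have h4 : Real.log (S.f x (u x)) + (n + 1) * Real.log ‖x‖ ≤ Real.log C := by
    have := Real.log_le_log (by positivity) (hF.f_mul_le x hxc (u x))
    rw [Real.log_mul hfpos.ne' (by positivity), Real.log_pow] at this
    push_cast at this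
    exact this
  have h5 : Real.log R ≤ Real.log 2 + Real.log ‖x‖ := by
    rw [← Real.log_mul two_ne_zero hr.ne']
    exact Real.log_le_log hR0 (by linarith)
  have h6 : Real.log (1 + ‖fderiv ℝ u x‖ ^ 2) ≤ Real.log (1 + (C + 1) ^ 2) := by
    have := hF.norm_fderiv_sol_le hu hR hCR hx hxR
    exact Real.log_le_log (by positivity) (by gcongr)
  have h7 := mul_le_mul_of_nonneg_left h5 (by positivity : (0 : ℝ) ≤ n + 1)
  have h8 := mul_le_mul_of_nonneg_left h6 (by positivity : (0 : ℝ) ≤ (n + 2) / 2)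
  have h9 : (0 : ℝ) ≤ n := by positivity
  linarith

end FarBound

end BarrierOperator

section InteriorInequality

variable {n : ℕ} {S : ExtSetting n} {C R₁ R : ℝ} {u : Euc n → ℝ} {x : Euc n}

theorem rpow_neg_five_quarters_le (hR : 1 ≤ R) : R ^ (-(5 : ℝ) / 4) ≤ 1 / R := by
  rw [one_div, ← Real.rpow_neg_one]
  exact Real.rpow_le_rpow_of_exponent_le hR (by norm_num)

theorem rpow_neg_five_quarters_eq (hR : 0 < R) :
    R ^ (-(5 : ℝ) / 4) = R ^ ((3 : ℝ) / 4) / R ^ 2 := by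
  rw [← Real.rpow_natCast R 2, ← Real.rpow_sub hR]
  norm_num

theorem pdW_solDom_eq (hx : x ∈ ball (0 : Euc n) R \ S.K) (w : Euc n → ℝ) (i : Fin n) :
    pdW (solDom S R) w x i = pd i w x := by
  rw [pdW, pd, fderivWithin_of_mem_nhds
    (mem_of_superset ((isOpen_ball_diff_K S R).mem_nhds hx) (ball_diff_K_subset_solDom S R))]

/-- The explicit interior bound for the linearized operator applied to the barrier. -/
theorem FarBound.Llin_barrier_le (hF : FarBound S C R₁) (hu : IsSol S R u) (hR : 16 * R₁ ≤ R)
    (hR' : 256 ≤ R) (hCR : (n ^ 2 + 2) * C / √R ≤ 1) {t last : Fin n} {A s : ℝ} (hA : 0 ≤ A)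
    (hs : |s| ≤ 1)
    (hx : x ∈ ball (EuclideanSpace.single last R) (R ^ ((3 : ℝ) / 4)) ∩ ball (0 : Euc n) R) :
    Llin (solDom S R) u
        (fun y => vartheta R u S.ul y + A / R ^ 2 * ‖y - EuclideanSpace.single last R‖ ^ 2
          + s * Tlin (solDom S R) R t last (fun z => u z - S.ul z) y) x
      ≤ (2 * n + 4 + (A + 2) * (n * (n + 2)) + 2 * (C * (C + 2) + n * (n + 2) * C))
        - (tangentialPart (Hess u x)⁻¹ x / R
          + R ^ (-(5 : ℝ) / 4) * radialPart (Hess u x)⁻¹ x)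
        + (6 * n ^ 2 * C + 4 * n * C + 2 * A) * ((Hess u x)⁻¹).trace / R ^ 2 := by
  have hR0 : 0 < R := by linarith
  have hx₀ : ‖x - EuclideanSpace.single last R‖ < R ^ ((3 : ℝ) / 4) := mem_ball_iff_norm.mp hx.1
  have hxR : ‖x‖ < R := mem_ball_zero_iff.mp hx.2
  have hR34 := rpow_three_quarters_le hR'
  have hd := sub_norm_le_norm_sub_single (x := x) hR0.le last
  have hxl : 3 / 4 * R ≤ ‖x‖ := by linarith
  have hx0 : x ≠ 0 := norm_pos_iff.mp (by linarith)
  have hxO := mem_ball_diff_K (hF.R₀_le_norm hR hxl) hxR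
  have hO := isOpen_ball_diff_K S R
  have hB := hu.inv_Hess_posSemidef hxO
  have hT : 0 ≤ ((Hess u x)⁻¹).trace := hB.trace_nonneg
  set O := ball (0 : Euc n) R \ S.K with hOdef
  set a := R ^ (-(1 : ℝ) / 2) with ha
  set b := R ^ (-(5 : ℝ) / 4) with hb
  have hb0 : 0 < b := by positivity
  have hO0 : O ⊆ {0}ᶜ := fun y hy h0 => by
    rw [mem_singleton_iff] at h0
    exact hy.2 (h0 ▸ interior_subset S.hK0)
  have hwO : ContDiffOn ℝ (⊤ : ℕ∞) (fun z => u z - S.ul z) O :=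
    hu.contDiffOn_ball_diff_K.sub (ul_contDiffOn_ball_diff_K S R)
  have hdist : ContDiffOn ℝ (⊤ : ℕ∞) (fun y : Euc n => R - ‖y‖) O :=
    contDiffOn_const.sub (contDiffOn_norm.mono hO0)
  have hdO : ContDiffOn ℝ (⊤ : ℕ∞)
      (fun y : Euc n => a * (R - ‖y‖) - 1 / 2 * b * (R - ‖y‖) ^ 2) O :=
    (contDiffOn_const.mul hdist).sub (contDiffOn_const.mul (hdist.pow 2))
  have hsqO : ContDiffOn ℝ (⊤ : ℕ∞)
      (fun y : Euc n => ‖y - EuclideanSpace.single last R‖ ^ 2) O :=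
    ((contDiff_id.sub contDiff_const).norm_sq ℝ).contDiffOn
  have hco : ContDiffOn ℝ (⊤ : ℕ∞) (fun y : Euc n => y t) O :=
    (EuclideanSpace.proj t : Euc n →L[ℝ] ℝ).contDiff.contDiffOn
  have hTO : ContDiffOn ℝ (⊤ : ℕ∞) (fun y => pd t (fun z => u z - S.ul z) y
      - 1 / R * (y t * pd last (fun z => u z - S.ul z) y)) O :=
    (hwO.pd hO t).sub (contDiffOn_const.mul (hco.mul (hwO.pd hO last)))
  have hsqO' : ContDiffOn ℝ (⊤ : ℕ∞)
      (fun y : Euc n => A / R ^ 2 * ‖y - EuclideanSpace.single last R‖ ^ 2) O :=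
    contDiffOn_const.mul hsqO
  have hTO' : ContDiffOn ℝ (⊤ : ℕ∞) (fun y => s * (pd t (fun z => u z - S.ul z) y
      - 1 / R * (y t * pd last (fun z => u z - S.ul z) y))) O := contDiffOn_const.mul hTO
  have hcongr : EqOn
      (fun y => vartheta R u S.ul y + A / R ^ 2 * ‖y - EuclideanSpace.single last R‖ ^ 2
        + s * Tlin (solDom S R) R t last (fun z => u z - S.ul z) y)
      (fun y => (u y - S.ul y) + (a * (R - ‖y‖) - 1 / 2 * b * (R - ‖y‖) ^ 2)
        + A / R ^ 2 * ‖y - EuclideanSpace.single last R‖ ^ 2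
        + s * (pd t (fun z => u z - S.ul z) y
          - 1 / R * (y t * pd last (fun z => u z - S.ul z) y))) O := fun y hy => by
    simp only [vartheta, Tlin, pdW_solDom_eq hy]
    ring
  rw [Llin_eq_ellOp hO (ball_diff_K_subset_solDom S R)
    ((((hwO.add hdO).add hsqO').add hTO').congr hcongr) hxO]
  change ellOp (Hess u x)⁻¹ (drift u x) _ x ≤ _
  rw [ellOp_congr _ _ hO hcongr hxO, ellOp_add _ _ hO ((hwO.add hdO).add hsqO') hTO' hxO,
    ellOp_add _ _ hO (hwO.add hdO) hsqO' hxO, ellOp_add _ _ hO hwO hdO hxO,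
    ellOp_const_mul _ _ hO hsqO _ hxO, ellOp_const_mul _ _ hO hTO _ hxO, ellOp_normSq]
  have h1 := hF.ellOp_sub_le hu hR hCR hxl hxR
  have hab : a - b * (R - ‖x‖) = b * (R ^ ((3 : ℝ) / 4) - (R - ‖x‖)) := by
    rw [ha, hb, rpow_neg_half_eq_mul hR0]
    ring
  have ha1 : a ≤ 1 := Real.rpow_le_one_of_one_le_of_nonpos (by linarith) (by norm_num)
  have h2 := ellOp_distance_le (u := u) hB (hu.inv_Hess_symm hxO) hx0 (R := R) (a := a) (b := b)
    (by rw [hab]; exact mul_nonneg hb0.le (by linarith))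
    (by nlinarith)
  have h3 : |∑ i, drift u x i * (2 * (x i - (EuclideanSpace.single last R : Euc n) i))|
      ≤ n * (n + 2) * R := abs_sum_drift_mul_le u x fun i => by
    have := abs_apply_le_norm (x - EuclideanSpace.single last R) i
    rw [PiLp.sub_apply] at this
    rw [abs_mul, abs_two]
    linarith
  have h4 := hF.abs_ellOp_tangential_le hu hR hCR hxl hxR t last
  set T := ((Hess u x)⁻¹).trace
  have h5 : A / R ^ 2 * (2 * T
      - ∑ i, drift u x i * (2 * (x i - (EuclideanSpace.single last R : Euc n) i)))
      ≤ 2 * A * T / R ^ 2 + A * (n * (n + 2)) := by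
    calc _ ≤ A / R ^ 2 * (2 * T + n * (n + 2) * R) :=
          mul_le_mul_of_nonneg_left (by linarith [(abs_le.mp h3).1]) (by positivity)
      _ = 2 * A * T / R ^ 2 + A * (n * (n + 2)) / R := by
          field_simp
      _ ≤ _ := by
          gcongr
          exact div_le_self (by positivity) (by linarith)
  set V := ellOp (Hess u x)⁻¹ (drift u x) (fun y => pd t (fun z => u z - S.ul z) y
      - 1 / R * (y t * pd last (fun z => u z - S.ul z) y)) x
  have h6 : s * V ≤ |V| := by
    calc s * V ≤ |s * V| := le_abs_self _
      _ = |s| * |V| := abs_mul _ _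
      _ ≤ 1 * |V| := mul_le_mul_of_nonneg_right hs (abs_nonneg _)
      _ = |V| := one_mul _
  have h7 : (6 * n ^ 2 * C + 4 * n * C + 2 * A) * T / R ^ 2 = 2 * n ^ 2 * C * T / R ^ 2
      + 2 * A * T / R ^ 2 + (4 * n ^ 2 * C + 4 * n * C) * T / R ^ 2 := by ring
  rw [h7]
  linarith

theorem trace_div_sq_le {B : Matrix (Fin n) (Fin n) ℝ} (hB : B.PosSemidef) (hx : x ≠ 0)
    (hR : 1 ≤ R) {c : ℝ} (hc : 2 * c ≤ R ^ ((3 : ℝ) / 4)) :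
    c * B.trace / R ^ 2
      ≤ (tangentialPart B x / R + R ^ (-(5 : ℝ) / 4) * radialPart B x) / 2 := by
  have hR0 : 0 < R := by linarith
  have hT : 0 ≤ B.trace := hB.trace_nonneg
  have h1 := tangentialPart_nonneg hB hx
  have h2 : R ^ (-(5 : ℝ) / 4) * tangentialPart B x ≤ tangentialPart B x / R := by
    have := mul_le_mul_of_nonneg_right (rpow_neg_five_quarters_le hR) h1
    rwa [one_div_mul_eq_div] at this
  calc c * B.trace / R ^ 2 ≤ R ^ ((3 : ℝ) / 4) / 2 * B.trace / R ^ 2 := by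
        gcongr
        linarith
    _ = R ^ (-(5 : ℝ) / 4) * B.trace / 2 := by
        rw [rpow_neg_five_quarters_eq hR0]
        ring
    _ ≤ _ := by
        rw [← tangentialPart_add_radialPart B x]
        linarith

end InteriorInequality

theorem Theta_barrier
    (n : ℕ) (S : ExtSetting n) (t last : Fin n)
    (ht : (t : ℕ) < n - 1) (hlast : (last : ℕ) = n - 1) :
    ∃ A : ℝ, 0 < A ∧ ∃ R₁ : ℝ, ∀ R : ℝ, 4 * S.R₀ < R → R₁ ≤ R →
      ∀ u : Euc n → ℝ, IsSol S R u → ∀ s : ℝ, s = 1 ∨ s = -1 →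
        (∀ x ∈ ball (EuclideanSpace.single last R) (R ^ ((3 : ℝ) / 4)) ∩ ball (0 : Euc n) R,
          Llin (solDom S R) u
            (fun y => vartheta R u S.ul y + A / R ^ 2 * ‖y - EuclideanSpace.single last R‖ ^ 2
              + s * Tlin (solDom S R) R t last (fun z => u z - S.ul z) y) x ≤ 0) ∧
        (∀ x ∈ frontier
            (ball (EuclideanSpace.single last R) (R ^ ((3 : ℝ) / 4)) ∩ ball (0 : Euc n) R),
          0 ≤ vartheta R u S.ul x + A / R ^ 2 * ‖x - EuclideanSpace.single last R‖ ^ 2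
              + s * Tlin (solDom S R) R t last (fun z => u z - S.ul z) x) := by
  obtain ⟨C, R₂, hF⟩ := exists_farBound S
  have hC := hF.one_le
  set A : ℝ := 2 * ((n ^ 2 + 2) * C) with hA
  have hA0 : 0 < A := by positivity
  set C₁ : ℝ := 2 * n + 4 + (A + 2) * (n * (n + 2)) + 2 * (C * (C + 2) + n * (n + 2) * C)
  set C₂ : ℝ := Real.log C + (n + 1) * Real.log 2 + (n + 2) / 2 * Real.log (1 + (C + 1) ^ 2)
  have hev : ∀ᶠ R : ℝ in atTop, 16 * R₂ ≤ R ∧ 256 ≤ R ∧ (n ^ 2 + 2) * C ≤ √R ∧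
      2 * (6 * n ^ 2 * C + 4 * n * C + 2 * A) ≤ R ^ ((3 : ℝ) / 4) ∧
      4 / 3 * (2 * C₁ + C₂) ≤ Real.log R :=
    (eventually_ge_atTop _).and <| (eventually_ge_atTop _).and <|
      (Real.tendsto_sqrt_atTop.eventually_ge_atTop _).and <|
      ((tendsto_rpow_atTop (by norm_num)).eventually_ge_atTop _).and <|
      Real.tendsto_log_atTop.eventually_ge_atTop _
  obtain ⟨R₁, hR₁⟩ := eventually_atTop.mp hev
  refine ⟨A, hA0, R₁, fun R _ hR u hu s hs => ?_⟩
  obtain ⟨hR16, hR256, hsqrt, hrpow, hlog⟩ := hR₁ R hR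
  have hs' : |s| ≤ 1 := by rcases hs with rfl | rfl <;> simp
  refine ⟨fun x hx => ?_, fun x hx => hF.boundary_nonneg hu hR16 hR256 le_rfl hs' hx⟩
  have hR0 : 0 < R := by linarith
  have hCR : (n ^ 2 + 2) * C / √R ≤ 1 := (div_le_one (Real.sqrt_pos.mpr hR0)).mpr hsqrt
  have hxR : ‖x‖ < R := mem_ball_zero_iff.mp hx.2
  have hxl : 3 / 4 * R ≤ ‖x‖ := by
    linarith [mem_ball_iff_norm.mp hx.1, rpow_three_quarters_le hR256,
      sub_norm_le_norm_sub_single (x := x) hR0.le last]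
  have hxO := mem_ball_diff_K (hF.R₀_le_norm hR16 hxl) hxR
  have h1 := hF.Llin_barrier_le hu hR16 hR256 hCR (t := t) hA0.le hs' hx
  have h2 := trace_div_sq_le (hu.inv_Hess_posSemidef hxO)
    (norm_pos_iff.mp (by linarith) : x ≠ 0) (by linarith) hrpow
  have h3 := hF.le_tangentialPart_add_radialPart hu hR16 hCR hxl hxR
  change _ ≤ C₁ - _ + _ at h1
  change _ - C₂ ≤ _ at h3
  linarith
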